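/- arXiv:1710.03221 — 3 statements merged into one kernel-verified Lean document; each statement's English description precedes it below -/
import Mathlib

section
/- For every real number m > -1, the moment of the complete elliptic integral of the first kind satisfies ∫_0^1 K(√x) x^m dx = 2 ∑_{i=0}^∞ Γ(m+1)² / ((2i+1) · Γ(m-i+1) · Γ(m+i+2)), where for nonpositive-integer arguments of Γ the corresponding reciprocal 1/Γ is interpreted as 0. -/
open Real

/-- The complete elliptic integral of the first kind as a function of `x = k²`:
`K(√x) = ∫_0^{π/2} (1 - x sin²θ)^{-1/2} dθ`. -/
noncomputable def Ksqrt (x : ℝ) : ℝ :=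
  ∫ θ in (0:ℝ)..(π/2), (1 - x * Real.sin θ ^ 2) ^ (-(1:ℝ)/2)

/-- The moment `∫₀¹ P_i(2x - 1) x ^ m dx` of the `i`-th shifted Legendre polynomial,
in closed form. -/
noncomputable def legendreMoment (m : ℝ) (i : ℕ) : ℝ :=
  Gamma (m + 1) ^ 2 / (Gamma (m - i + 1) * Gamma (m + i + 2))

theorem legendreMoment_zero {m : ℝ} (hm : -1 < m) : (m + 1) * legendreMoment m 0 = 1 := by
  have h1 : 0 < m + 1 := by linarith
  have hG := (Gamma_pos_of_pos h1).ne'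
  have h2 : Gamma (m + 2) = (m + 1) * Gamma (m + 1) := by
    rw [← Gamma_add_one h1.ne']; ring_nf
  simp only [legendreMoment, Nat.cast_zero, sub_zero, add_zero, h2]
  field_simp

theorem legendreMoment_succ {m : ℝ} (hm : -1 < m) (i : ℕ) :
    (m + i + 2) * legendreMoment m (i + 1) = (m - i) * legendreMoment m i := by
  have hi : (0 : ℝ) ≤ i := i.cast_nonneg
  have h1 : 0 < m + i + 2 := by linarith
  have hG := (Gamma_pos_of_pos h1).ne'
  have h2 : Gamma (m + (i + 1 : ℕ) + 2) = (m + i + 2) * Gamma (m + i + 2) := by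
    rw [← Gamma_add_one h1.ne']; push_cast; ring_nf
  have h3 : m - (i + 1 : ℕ) + 1 = m - i := by push_cast; ring
  simp only [legendreMoment, h2, h3]
  rcases eq_or_ne (m - i) 0 with h | h
  · simp [h]
  · rw [Gamma_add_one h]
    rcases eq_or_ne (Gamma (m - i)) 0 with h0 | h0
    · simp [h0]
    · field_simp

theorem summable_abs_legendreMoment_div {m : ℝ} (hm : -1 < m) :
    Summable fun i : ℕ => |legendreMoment m i| / (2 * i + 1) := by
  have key : Summable fun i : ℕ => |legendreMoment m i| / (m + i + 2) := by
    obtain ⟨N, hN⟩ := exists_nat_gt m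
    rw [← summable_nat_add_iff N]
    refine summable_of_sum_range_le (c := |legendreMoment m N| / (2 * m + 2))
      (fun i => div_nonneg (abs_nonneg _) ?_) fun n => ?_
    · have : (0 : ℝ) ≤ (i + N : ℕ) := Nat.cast_nonneg _
      linarith
    have hterm : ∀ i : ℕ, |legendreMoment m (i + N)| / (m + (i + N : ℕ) + 2) =
        (|legendreMoment m (i + N)| - |legendreMoment m (i + 1 + N)|) / (2 * m + 2) := by
      intro i
      have h0 : (0 : ℝ) ≤ i := i.cast_nonneg
      have h1 : 0 < m + (i + N : ℕ) + 2 := by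
        have : (0 : ℝ) ≤ (i + N : ℕ) := Nat.cast_nonneg _
        linarith
      have h2 : 0 < 2 * m + 2 := by linarith
      have h3 := congrArg abs (legendreMoment_succ hm (i + N))
      rw [abs_mul, abs_mul, abs_of_pos h1,
        abs_of_neg (a := m - (i + N : ℕ)) (by push_cast; linarith),
        show i + N + 1 = i + 1 + N by ring] at h3
      rw [div_eq_div_iff h1.ne' h2.ne']
      linear_combination h3
    rw [Finset.sum_congr rfl fun i _ => hterm i, ← Finset.sum_div,
      Finset.sum_range_sub' (fun i => |legendreMoment m (i + N)|), zero_add]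
    have : 0 < 2 * m + 2 := by linarith
    gcongr
    linarith [abs_nonneg (legendreMoment m (n + N))]
  refine (key.mul_left (m + 2)).of_nonneg_of_le (fun i => by positivity) fun i => ?_
  have h0 : (0 : ℝ) ≤ i := i.cast_nonneg
  have h1 : 0 < m + i + 2 := by linarith
  rw [mul_div_assoc', div_le_div_iff₀ (by positivity) h1]
  have : m + i + 2 ≤ (m + 2) * (2 * i + 1) := by nlinarith
  nlinarith [mul_le_mul_of_nonneg_left this (abs_nonneg (legendreMoment m i))]

theorem exists_abs_legendreMoment_le {m : ℝ} (hm : -1 < m) :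
    ∃ C, 0 ≤ C ∧ ∀ i : ℕ, |legendreMoment m i| ≤ C * (2 * i + 1) := by
  have hs := summable_abs_legendreMoment_div hm
  refine ⟨∑' i : ℕ, |legendreMoment m i| / (2 * i + 1),
    tsum_nonneg fun i => by positivity, fun i => ?_⟩
  · rw [← div_le_iff₀ (by positivity)]
    exact hs.le_tsum i fun j _ => by positivity

/-- The generating function of the Legendre moments. -/
noncomputable def legendreMomentGen (m u : ℝ) : ℝ := ∑' i : ℕ, legendreMoment m i * u ^ i

theorem summable_legendreMoment_mul_pow {m u : ℝ} (hm : -1 < m) (hu : |u| < 1) :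
    Summable fun i : ℕ => legendreMoment m i * u ^ i := by
  obtain ⟨C, hC, hb⟩ := exists_abs_legendreMoment_le hm
  have hu' : ‖|u|‖ < 1 := by simpa using hu
  have h0 := summable_pow_mul_geometric_of_norm_lt_one 0 hu'
  have h1 := summable_pow_mul_geometric_of_norm_lt_one 1 hu'
  refine Summable.of_norm_bounded (((h1.mul_left 2).add h0).mul_left C) fun i => ?_
  rw [norm_mul, norm_pow, norm_eq_abs, norm_eq_abs]
  calc _ ≤ C * (2 * i + 1) * |u| ^ i := by gcongr; exact hb i
    _ = _ := by ring

theorem summable_legendreMoment_deriv {m u : ℝ} (hm : -1 < m) (hu : |u| < 1) :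
    Summable fun i : ℕ => |legendreMoment m i| * (i * |u| ^ (i - 1)) := by
  obtain ⟨C, hC, hb⟩ := exists_abs_legendreMoment_le hm
  have hu' : ‖|u|‖ < 1 := by simpa using hu
  have h0 := summable_pow_mul_geometric_of_norm_lt_one 0 hu'
  have h1 := summable_pow_mul_geometric_of_norm_lt_one 1 hu'
  have h2 := summable_pow_mul_geometric_of_norm_lt_one 2 hu'
  rw [← summable_nat_add_iff 1]
  refine (((h2.mul_left 2).add ((h1.mul_left 5).add (h0.mul_left 3))).mul_left C).of_nonneg_of_le
    (fun i => by positivity) fun i => ?_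
  have := hb (i + 1)
  push_cast at this ⊢
  calc _ ≤ C * (2 * (i + 1) + 1) * ((i + 1) * |u| ^ i) := by
        gcongr
    _ = _ := by ring

theorem hasDerivAt_legendreMomentGen {m u : ℝ} (hm : -1 < m) (hu : |u| < 1) :
    HasDerivAt (legendreMomentGen m) (∑' i : ℕ, legendreMoment m i * (i * u ^ (i - 1))) u := by
  obtain ⟨r, hr, hr1⟩ := exists_between hu
  have hr0 : 0 ≤ r := (abs_nonneg u).trans hr.le
  have hr' : |r| < 1 := by rwa [abs_of_nonneg hr0]
  refine hasDerivAt_tsum_of_isPreconnected (t := Set.Ioo (-r) r) (y₀ := u)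
    (g := fun i y => legendreMoment m i * y ^ i)
    (summable_legendreMoment_deriv hm hr') isOpen_Ioo isPreconnected_Ioo
    (fun n y _ => (hasDerivAt_pow n y).const_mul _) (fun n y hy => ?_) (abs_lt.1 hr)
    (summable_legendreMoment_mul_pow hm hu) (abs_lt.1 hr)
  rw [norm_mul, norm_mul, norm_pow, norm_natCast, norm_eq_abs, norm_eq_abs, abs_of_nonneg hr0]
  have := (abs_lt.2 hy).le
  gcongr

/-- The generating function of the Legendre moments solves a first order differential equation. -/
theorem legendreMomentGen_ode {m u : ℝ} (hm : -1 < m) (hu : |u| < 1) :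
    u * (1 + u) * (∑' i : ℕ, legendreMoment m i * (i * u ^ (i - 1)))
      + (m + 1 - m * u) * legendreMomentGen m u = 1 := by
  have hF := summable_legendreMoment_mul_pow hm hu
  have hE : Summable fun i : ℕ => legendreMoment m i * (i * u ^ (i - 1)) := by
    refine (summable_legendreMoment_deriv hm hu).of_norm_bounded fun i => ?_
    simp
  have hpow : ∀ i : ℕ, (i : ℝ) * u ^ (i - 1) * u = i * u ^ i := by
    rintro (_ | i)
    · simp
    · simp [pow_succ, mul_assoc]
  have hA : HasSum (fun i : ℕ => (m + i + 1) * legendreMoment m i * u ^ i)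
      (u * (∑' i : ℕ, legendreMoment m i * (i * u ^ (i - 1)))
        + (m + 1) * legendreMomentGen m u) := by
    convert! (hE.hasSum.mul_left u).add (hF.hasSum.mul_left (m + 1)) using 1
    ext i
    linear_combination -legendreMoment m i * hpow i
  have hB : HasSum (fun i : ℕ => (m + (i + 1 : ℕ) + 1) * legendreMoment m (i + 1) * u ^ (i + 1))
      (u * (m * legendreMomentGen m u
        - u * (∑' i : ℕ, legendreMoment m i * (i * u ^ (i - 1))))) := by
    convert! ((hF.hasSum.mul_left m).sub (hE.hasSum.mul_left u)).mul_left u using 1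
    ext i
    push_cast
    linear_combination u ^ (i + 1) * legendreMoment_succ hm i + u * legendreMoment m i * hpow i
  have h := hA.summable.tsum_eq_zero_add
  rw [hA.tsum_eq, hB.tsum_eq] at h
  have h0 := legendreMoment_zero hm
  simp only [Nat.cast_zero, add_zero, pow_zero, mul_one, h0] at h
  linear_combination h

theorem intervalIntegrable_and_integral_rpow_mul_sqrt {m c : ℝ} (hm : -1 < m) (hc0 : 0 < c)
    (hc1 : c < 1) :
    IntervalIntegrable (fun x : ℝ => (1 - x * c) ^ (-(1 : ℝ) / 2) * x ^ m)
        MeasureTheory.volume 0 1 ∧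
      ∫ x in (0 : ℝ)..1, (1 - x * c) ^ (-(1 : ℝ) / 2) * x ^ m =
        (1 + (1 - √(1 - c)) / (1 + √(1 - c))) *
          legendreMomentGen m ((1 - √(1 - c)) / (1 + √(1 - c))) := by
  set u : ℝ → ℝ := fun x => (1 - √(1 - x * c)) / (1 + √(1 - x * c)) with hu
  set Φ : ℝ → ℝ := fun x => x ^ (m + 1) * ((1 + u x) * legendreMomentGen m (u x)) with hΦ
  have hpos : ∀ x ∈ Set.Icc (0 : ℝ) 1, 0 < 1 - x * c := fun x hx => by nlinarith [hx.1, hx.2]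
  have hu1 : ∀ x ∈ Set.Icc (0 : ℝ) 1, |u x| < 1 := fun x hx => by
    have hw := sqrt_pos.2 (hpos x hx)
    rw [abs_lt, hu]
    constructor
    · rw [lt_div_iff₀ (by linarith)]; linarith
    · rw [div_lt_iff₀ (by linarith)]; linarith
  have hcont : ContinuousOn Φ (Set.Icc 0 1) := by
    have hcu : ContinuousOn u (Set.Icc 0 1) := by
      refine ContinuousOn.div (by fun_prop) (by fun_prop) fun x _ => ?_
      positivity
    have hcF : ContinuousOn (fun x => legendreMomentGen m (u x)) (Set.Icc 0 1) := fun x hx =>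
      (hasDerivAt_legendreMomentGen hm (hu1 x hx)).continuousAt.comp_continuousWithinAt (hcu x hx)
    have hcp : ContinuousOn (fun x : ℝ => x ^ (m + 1)) (Set.Icc 0 1) :=
      (continuous_rpow_const (by linarith)).continuousOn
    exact hcp.mul ((continuousOn_const.add hcu).mul hcF)
  have hderiv : ∀ x ∈ Set.Ioo (0 : ℝ) 1,
      HasDerivAt Φ ((1 - x * c) ^ (-(1 : ℝ) / 2) * x ^ m) x := by
    intro x hx
    have hx' := Set.Ioo_subset_Icc_self hx
    have hp := hpos x hx'
    have hwp := sqrt_pos.2 hp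
    have hw2 := sq_sqrt hp.le
    have hode := legendreMomentGen_ode hm (hu1 x hx')
    have hdF := hasDerivAt_legendreMomentGen hm (hu1 x hx')
    have hdw : HasDerivAt (fun x : ℝ => √(1 - x * c)) (-c / (2 * √(1 - x * c))) x := by
      have h := (((hasDerivAt_id x).mul_const c).const_sub 1).sqrt hp.ne'
      simpa using h
    have hdu : HasDerivAt u (c / (√(1 - x * c) * (1 + √(1 - x * c)) ^ 2)) x := by
      have h := (hdw.const_sub 1).div (hdw.const_add 1) (by positivity)
      convert! h using 1
      field_simp
      ring
    have h := (hasDerivAt_rpow_const (p := m + 1) (Or.inl hx.1.ne')).mul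
      ((hdu.const_add 1).mul (hdF.comp x hdu))
    convert! h using 1
    have hr : (1 - x * c) ^ (-(1 : ℝ) / 2) = (√(1 - x * c))⁻¹ := by
      rw [sqrt_eq_rpow, ← rpow_neg hp.le]; norm_num
    rw [hr, add_sub_cancel_right, rpow_add_one hx.1.ne']
    have huv : u x = (1 - √(1 - x * c)) / (1 + √(1 - x * c)) := rfl
    simp only [Pi.mul_apply, Function.comp_apply]
    generalize (∑' i : ℕ, legendreMoment m i * (i * u x ^ (i - 1))) = D at *
    generalize legendreMomentGen m (u x) = F at *
    rw [huv] at hode ⊢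
    generalize √(1 - x * c) = w at *
    have hc : c = (1 - w ^ 2) / x := by
      rw [eq_div_iff hx.1.ne']; linarith
    have hx0 := hx.1.ne'
    rw [hc]
    field_simp
    field_simp at hode
    linear_combination (-(1 + w) * x ^ m) * hode
  have hint : IntervalIntegrable (fun x : ℝ => (1 - x * c) ^ (-(1 : ℝ) / 2) * x ^ m)
      MeasureTheory.volume 0 1 := by
    rw [intervalIntegrable_iff_integrableOn_Ioc_of_le zero_le_one]
    refine intervalIntegral.integrableOn_deriv_of_nonneg hcont hderiv fun x hx => ?_
    exact mul_nonneg (rpow_nonneg (hpos x (Set.Ioo_subset_Icc_self hx)).le _)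
      (rpow_nonneg hx.1.le _)
  refine ⟨hint, ?_⟩
  rw [intervalIntegral.integral_eq_sub_of_hasDerivAt_of_le zero_le_one hcont hderiv hint]
  simp [hΦ, hu, zero_rpow (show m + 1 ≠ 0 by linarith)]

theorem hasDerivAt_sin_div_one_add_cos_pow {θ : ℝ} (hθ : 0 < 1 + cos θ) (i : ℕ) :
    HasDerivAt (fun θ => 2 / (2 * i + 1) * (sin θ / (1 + cos θ)) ^ (2 * i + 1))
      ((1 + (sin θ / (1 + cos θ)) ^ 2) * ((sin θ / (1 + cos θ)) ^ 2) ^ i) θ := by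
  have h := (((hasDerivAt_sin θ).div ((hasDerivAt_cos θ).const_add 1) hθ.ne').pow
    (2 * i + 1)).const_mul (2 / (2 * (i : ℝ) + 1))
  convert! h using 1
  have h1 : (2 * (i : ℝ) + 1) ≠ 0 := by positivity
  rw [← pow_mul, Nat.add_sub_cancel]
  generalize (sin θ / (1 + cos θ)) ^ (2 * i) = P
  push_cast
  field_simp
  linear_combination (-P) * sin_sq_add_cos_sq θ

theorem one_add_cos_pos_of_mem {θ : ℝ} (hθ : θ ∈ Set.Icc 0 (π / 2)) : 0 < 1 + cos θ := by
  linarith [cos_nonneg_of_mem_Icc ⟨by linarith [hθ.1, pi_pos], hθ.2⟩]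

theorem continuousOn_sin_div_one_add_cos_sq_pow (i : ℕ) :
    ContinuousOn (fun θ => (1 + (sin θ / (1 + cos θ)) ^ 2) * ((sin θ / (1 + cos θ)) ^ 2) ^ i)
      (Set.Icc 0 (π / 2)) := by
  have : ContinuousOn (fun θ => sin θ / (1 + cos θ)) (Set.Icc 0 (π / 2)) :=
    ContinuousOn.div (by fun_prop) (by fun_prop) fun θ hθ => (one_add_cos_pos_of_mem hθ).ne'
  fun_prop

theorem integral_sin_div_one_add_cos_sq_pow (i : ℕ) :
    ∫ θ in (0 : ℝ)..(π / 2),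
      (1 + (sin θ / (1 + cos θ)) ^ 2) * ((sin θ / (1 + cos θ)) ^ 2) ^ i =
        2 / (2 * (i : ℝ) + 1) := by
  have hle : (0 : ℝ) ≤ π / 2 := by positivity
  rw [intervalIntegral.integral_eq_sub_of_hasDerivAt (fun θ hθ =>
    hasDerivAt_sin_div_one_add_cos_pow
      (one_add_cos_pos_of_mem (by rwa [Set.uIcc_of_le hle] at hθ)) i)]
  · simp
  · refine ContinuousOn.intervalIntegrable ?_
    rw [Set.uIcc_of_le hle]
    exact continuousOn_sin_div_one_add_cos_sq_pow i

open MeasureTheory in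
theorem integrable_tsum_of_summable_integral_norm {α : Type*} [MeasurableSpace α]
    {μ : Measure α} {F : ℕ → α → ℝ} (hF : ∀ i, Integrable (F i) μ)
    (hsum : Summable fun i => ∫ a, ‖F i a‖ ∂μ)
    (hmeas : AEStronglyMeasurable (fun a => ∑' i, F i a) μ) :
    Integrable (fun a => ∑' i, F i a) μ := by
  refine ⟨hmeas, ?_⟩
  calc ∫⁻ a, ‖∑' i, F i a‖ₑ ∂μ ≤ ∫⁻ a, ∑' i, ‖F i a‖ₑ ∂μ :=
        lintegral_mono fun a => enorm_tsum_le_tsum_enorm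
    _ = ∑' i, ∫⁻ a, ‖F i a‖ₑ ∂μ := lintegral_tsum fun i => (hF i).1.enorm
    _ = ∑' i, ENNReal.ofReal (∫ a, ‖F i a‖ ∂μ) := by
        simp_rw [ofReal_integral_norm_eq_lintegral_enorm (hF _)]
    _ = ENNReal.ofReal (∑' i, ∫ a, ‖F i a‖ ∂μ) :=
        (ENNReal.ofReal_tsum_of_nonneg (fun i => integral_nonneg fun a => norm_nonneg _) hsum).symm
    _ < ⊤ := ENNReal.ofReal_lt_top

open MeasureTheory in
theorem moments_of_Ksqrt (m : ℝ) (hm : m > -1) :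
    (∫ x in (0:ℝ)..1, Ksqrt x * x ^ m)
      = 2 * ∑' i : ℕ, Real.Gamma (m + 1) ^ 2 /
          ((2 * (i:ℝ) + 1) * Real.Gamma (m - i + 1) * Real.Gamma (m + i + 2)) := by
  have hle : (0 : ℝ) ≤ π / 2 := by positivity
  set μ : Measure ℝ := volume.restrict (Set.Ioc 0 1)
  set ν : Measure ℝ := volume.restrict (Set.Ioc 0 (π / 2)) with hν
  set f : ℝ → ℝ → ℝ := fun x θ => (1 - x * sin θ ^ 2) ^ (-(1 : ℝ) / 2) * x ^ m with hf
  set F : ℕ → ℝ → ℝ := fun i θ => legendreMoment m i *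
    ((1 + (sin θ / (1 + cos θ)) ^ 2) * ((sin θ / (1 + cos θ)) ^ 2) ^ i) with hFdef
  have hFi : ∀ i, Integrable (F i) ν := fun i =>
    (((continuousOn_sin_div_one_add_cos_sq_pow i).integrableOn_Icc).mono_set
      Set.Ioc_subset_Icc_self).const_mul _
  have hFnorm : ∀ i, ∫ θ, ‖F i θ‖ ∂ν = 2 * (|legendreMoment m i| / (2 * i + 1)) := fun i => by
    have h : ∀ θ, ‖F i θ‖ = |legendreMoment m i| *
        ((1 + (sin θ / (1 + cos θ)) ^ 2) * ((sin θ / (1 + cos θ)) ^ 2) ^ i) := fun θ => by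
      rw [norm_mul, norm_eq_abs, norm_of_nonneg (by positivity)]
    simp_rw [h]
    rw [integral_const_mul, hν, ← intervalIntegral.integral_of_le hle,
      integral_sin_div_one_add_cos_sq_pow]
    ring
  have hFint : ∀ i, ∫ θ, F i θ ∂ν = 2 * (legendreMoment m i / (2 * i + 1)) := fun i => by
    rw [integral_const_mul, hν, ← intervalIntegral.integral_of_le hle,
      integral_sin_div_one_add_cos_sq_pow]
    ring
  have hFsum : Summable fun i => ∫ θ, ‖F i θ‖ ∂ν := by
    simp_rw [hFnorm]
    exact (summable_abs_legendreMoment_div hm).mul_left 2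
  have hinner : ∀ᵐ θ ∂ν, Integrable (fun x => f x θ) μ ∧ ∫ x, f x θ ∂μ = ∑' i, F i θ := by
    have hne : ∀ᵐ θ ∂ν, θ ≠ π / 2 := ae_restrict_of_ae (Measure.ae_ne volume _)
    filter_upwards [hne, ae_restrict_mem measurableSet_Ioc] with θ hθ1 hθ
    have hlt : θ < π / 2 := lt_of_le_of_ne hθ.2 hθ1
    have hs := sin_pos_of_pos_of_lt_pi hθ.1 (by linarith)
    have hcos := cos_pos_of_mem_Ioo ⟨by linarith [hθ.1], hlt⟩
    have hsc := sin_sq_add_cos_sq θ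
    obtain ⟨h1, h2⟩ := intervalIntegrable_and_integral_rpow_mul_sqrt (c := sin θ ^ 2) hm
      (by positivity) (by nlinarith)
    rw [intervalIntegrable_iff_integrableOn_Ioc_of_le zero_le_one] at h1
    rw [intervalIntegral.integral_of_le zero_le_one] at h2
    have hsq : √(1 - sin θ ^ 2) = cos θ := by
      rw [← cos_sq', sqrt_sq hcos.le]
    have htan : (1 - cos θ) / (1 + cos θ) = (sin θ / (1 + cos θ)) ^ 2 := by
      field_simp
      linear_combination -hsc
    rw [hsq, htan, legendreMomentGen, ← tsum_mul_left] at h2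
    refine ⟨h1, h2.trans (tsum_congr fun i => ?_)⟩
    simp only [hFdef]
    ring
  have hfm : AEStronglyMeasurable (Function.uncurry f) (μ.prod ν) := by
    refine Measurable.aestronglyMeasurable ?_
    simp only [hf, Function.uncurry_def]
    fun_prop
  have htsm : AEStronglyMeasurable (fun θ => ∑' i, F i θ) ν :=
    (hfm.prod_swap.integral_prod_right').congr (hinner.mono fun θ h => h.2)
  have hfi : Integrable (Function.uncurry f) (μ.prod ν) := by
    rw [integrable_prod_iff' hfm]
    refine ⟨hinner.mono fun θ h => h.1, ?_⟩
    refine (integrable_tsum_of_summable_integral_norm hFi hFsum htsm).congr ?_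
    filter_upwards [hinner] with θ hθ
    rw [← hθ.2]
    refine setIntegral_congr_fun measurableSet_Ioc fun x hx => ?_
    have h0 : 0 ≤ 1 - x * sin θ ^ 2 := by
      nlinarith [sin_sq_le_one θ, sq_nonneg (sin θ), hx.1, hx.2]
    exact (norm_of_nonneg (mul_nonneg (rpow_nonneg h0 _) (rpow_nonneg hx.1.le _))).symm
  calc (∫ x in (0:ℝ)..1, Ksqrt x * x ^ m) = ∫ x, ∫ θ, f x θ ∂ν ∂μ := by
        rw [intervalIntegral.integral_of_le zero_le_one]
        refine integral_congr_ae (Filter.Eventually.of_forall fun x => ?_)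
        simp only [hf, Ksqrt]
        rw [intervalIntegral.integral_of_le hle, ← integral_mul_const]
    _ = ∫ θ, ∫ x, f x θ ∂μ ∂ν := integral_integral_swap hfi
    _ = ∫ θ, ∑' i, F i θ ∂ν := integral_congr_ae (hinner.mono fun θ h => h.2)
    _ = ∑' i, ∫ θ, F i θ ∂ν := (integral_tsum_of_summable_integral_norm hFi hFsum).symm
    _ = _ := by
        simp_rw [hFint]
        rw [tsum_mul_left]
        congr 1
        refine tsum_congr fun i => ?_
        rw [legendreMoment, div_div]
        congr 1
        ring
end

section
/- The series ∑_{n=1}^∞ C(4n,2n) · C(2n,n) / (n · 64^n) equals 6 ln 2 - 2 ln(1+√2) - (16/π) · Im Li₂((√2-1)·i). -/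
open Real

/-- The imaginary part of `Li₂((√2-1)·i)`, given explicitly by the series
`∑_{k=0}^∞ (-1)^k (√2-1)^{2k+1} / (2k+1)²`. -/
noncomputable def imLi2 : ℝ :=
  ∑' k : ℕ, (-1) ^ k * (Real.sqrt 2 - 1) ^ (2*k+1) / (2 * (k:ℝ) + 1)^2

theorem integral_cos_pow_two_mul (n : ℕ) :
    ∫ t in (0 : ℝ)..π / 2, cos t ^ (2 * n) = π / 2 * (n.centralBinom / 4 ^ n) := by
  have h : ∏ i ∈ Finset.range n, (2 * (i : ℝ) + 1) / (2 * i + 2) = n.centralBinom / 4 ^ n := by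
    induction n with
    | zero => simp
    | succ n ih =>
      have h : ((n : ℝ) + 1) * (n + 1).centralBinom = 2 * (2 * n + 1) * n.centralBinom := by
        exact_mod_cast n.succ_mul_centralBinom_succ
      rw [Finset.prod_range_succ, ih, div_mul_div_comm, div_eq_div_iff (by positivity)
        (by positivity), pow_succ]
      linear_combination (-2 * 4 ^ n : ℝ) * h
  rw [EulerSine.integral_cos_pow_eq, integral_sin_pow_even, h]
  ring

theorem multichoose_one_half (n : ℕ) :
    Ring.multichoose (1 / 2 : ℝ) n = n.centralBinom / 4 ^ n := by
  have key (n : ℕ) : (n.factorial : ℝ) * Ring.multichoose (1 / 2 : ℝ) n =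
      (ascPochhammer ℝ n).eval (1 / 2) := by
    have := Ring.factorial_nsmul_multichoose_eq_ascPochhammer (1 / 2 : ℝ) n
    rw [nsmul_eq_mul] at this
    rw [this, Polynomial.ascPochhammer_smeval_eq_eval]
  induction n with
  | zero => simp
  | succ n ih =>
    have h : ((n : ℝ) + 1) * (n + 1).centralBinom = 2 * (2 * n + 1) * n.centralBinom := by
      exact_mod_cast n.succ_mul_centralBinom_succ
    have hn : (n.factorial : ℝ) ≠ 0 := by positivity
    have h1 := key (n + 1)
    rw [ascPochhammer_succ_eval, ← key n, ih, Nat.factorial_succ] at h1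
    push_cast at h1
    have h2 : ((n : ℝ) + 1) * Ring.multichoose (1 / 2 : ℝ) (n + 1) =
        n.centralBinom / 4 ^ n * (1 / 2 + n) := by
      apply mul_left_cancel₀ hn
      linear_combination h1
    have hn1 : (n : ℝ) + 1 ≠ 0 := by positivity
    apply mul_left_cancel₀ hn1
    rw [h2, ← mul_div_assoc, h, pow_succ]
    field_simp
    ring

theorem hasSum_centralBinom_mul_pow {x : ℝ} (hx : |x| < 1) :
    HasSum (fun n : ℕ ↦ (n.centralBinom : ℝ) / 4 ^ n * x ^ n) (1 / √(1 - x)) := by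
  have h := (one_div_one_sub_rpow_hasFPowerSeriesOnBall_zero (1 / 2)).hasSum (y := x)
    (by simpa [enorm_eq_nnnorm, ← NNReal.coe_lt_coe] using hx)
  simp only [FormalMultilinearSeries.ofScalars_apply_eq, ← Ring.multichoose_eq,
    multichoose_one_half, zero_add, ← Real.sqrt_eq_rpow, smul_eq_mul] at h
  exact h

theorem hasSum_centralBinom_div_mul_pow {x : ℝ} (hx : |x| < 1) :
    HasSum (fun n : ℕ ↦ ((n + 1).centralBinom : ℝ) / 4 ^ (n + 1) / (n + 1) * x ^ (n + 1))
      (2 * log 2 - 2 * log (1 + √(1 - x))) := by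
  have hball {r y : ℝ} : y ∈ Metric.ball (0 : ℝ) r ↔ |y| < r := by simp
  obtain ⟨r, hxr, hr1⟩ := exists_between hx
  have hr0 : 0 < r := (abs_nonneg x).trans_lt hxr
  have hc (n : ℕ) : (n.centralBinom : ℝ) / 4 ^ n ≤ 1 :=
    div_le_one_of_le₀ (by exact_mod_cast n.centralBinom_le_four_pow) (by positivity)
  have hgeom : Summable fun n : ℕ ↦ r ^ n := summable_geometric_of_lt_one hr0.le hr1
  have hle (n : ℕ) {y : ℝ} (hy : |y| < r) :
      ‖((n + 1).centralBinom : ℝ) / 4 ^ (n + 1) * y ^ n‖ ≤ r ^ n := by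
    rw [norm_mul, norm_pow, Real.norm_eq_abs, Real.norm_eq_abs, abs_of_nonneg (by positivity)]
    calc _ ≤ 1 * r ^ n := by gcongr; exact hc _
      _ = _ := one_mul _
  have hterm (n : ℕ) (y : ℝ) : HasDerivAt
      (fun y : ℝ ↦ ((n + 1).centralBinom : ℝ) / 4 ^ (n + 1) / (n + 1) * y ^ (n + 1))
      (((n + 1).centralBinom : ℝ) / 4 ^ (n + 1) * y ^ n) y := by
    refine ((hasDerivAt_pow (n + 1) y).const_mul
      (((n + 1).centralBinom : ℝ) / 4 ^ (n + 1) / (n + 1))).congr_deriv ?_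
    push_cast
    field_simp
  have hsum : Summable fun n : ℕ ↦
      ((n + 1).centralBinom : ℝ) / 4 ^ (n + 1) / (n + 1) * x ^ (n + 1) := by
    refine Summable.of_norm_bounded hgeom fun n ↦ ?_
    have h1 : ((n + 1).centralBinom : ℝ) / 4 ^ (n + 1) / (n + 1) * x ^ (n + 1) =
        ((n + 1).centralBinom : ℝ) / 4 ^ (n + 1) * x ^ n * (x / (n + 1)) := by ring
    have h2 : ‖x / ((n : ℝ) + 1)‖ ≤ 1 := by
      rw [norm_div, Real.norm_eq_abs, Real.norm_eq_abs,
        abs_of_pos (by positivity : (0 : ℝ) < n + 1)]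
      exact div_le_one_of_le₀ (by linarith [Nat.cast_nonneg (α := ℝ) n]) (by positivity)
    rw [h1, norm_mul]
    exact mul_le_of_le_one_right (norm_nonneg _) h2 |>.trans (hle n hxr)
  have hderiv {y : ℝ} (hy : |y| < r) : HasDerivAt
      (fun y : ℝ ↦ ∑' n : ℕ, ((n + 1).centralBinom : ℝ) / 4 ^ (n + 1) / (n + 1) * y ^ (n + 1))
      (1 / (√(1 - y) * (1 + √(1 - y)))) y := by
    refine (hasDerivAt_tsum_of_isPreconnected hgeom Metric.isOpen_ball
      (convex_ball (0 : ℝ) r).isPreconnected (fun n y _ ↦ hterm n y)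
      (fun n y hy ↦ hle n (hball.1 hy)) (hball.2 hxr) hsum (hball.2 hy)).congr_deriv ?_
    have hy1 : 0 < 1 - y := by linarith [(abs_lt.1 hy).2]
    have hs : 0 < √(1 - y) := Real.sqrt_pos.2 hy1
    rcases eq_or_ne y 0 with rfl | hy0
    · rw [tsum_eq_single 0 fun n hn ↦ by simp [hn]]
      norm_num [Nat.centralBinom]
    · have h := (hasSum_nat_add_iff' 1).2 (hasSum_centralBinom_mul_pow (hy.trans hr1))
      have h' := h.div_const y
      simp only [Finset.range_one, Finset.sum_singleton, pow_zero, Nat.centralBinom_zero,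
        Nat.cast_one, div_one, mul_one] at h'
      refine (tsum_congr fun n ↦ ?_).trans (h'.tsum_eq.trans ?_)
      · rw [pow_succ y]; field_simp
      · have hsq := Real.sq_sqrt hy1.le
        field_simp
        linear_combination -hsq
  have hderiv' {y : ℝ} (hy : |y| < r) : HasDerivAt (fun y : ℝ ↦ 2 * log 2 - 2 * log (1 + √(1 - y)))
      (1 / (√(1 - y) * (1 + √(1 - y)))) y := by
    have hy1 : 0 < 1 - y := by linarith [(abs_lt.1 hy).2]
    have hs : 0 < √(1 - y) := Real.sqrt_pos.2 hy1
    have h := ((((((hasDerivAt_id' y).const_sub 1).sqrt hy1.ne').const_add 1).log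
      (by positivity)).const_mul 2).const_sub (2 * log 2)
    refine h.congr_deriv ?_
    field_simp
  have heq := Metric.isOpen_ball.eqOn_of_deriv_eq (convex_ball (0 : ℝ) r).isPreconnected
    (fun y hy ↦ (hderiv (hball.1 hy)).differentiableAt.differentiableWithinAt)
    (fun y hy ↦ (hderiv' (hball.1 hy)).differentiableAt.differentiableWithinAt)
    (fun y hy ↦ (hderiv (hball.1 hy)).deriv.trans (hderiv' (hball.1 hy)).deriv.symm)
    (Metric.mem_ball_self hr0) (by norm_num) (hball.2 hxr)
  exact hsum.hasSum_iff.2 heq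

theorem hasSum_centralBinom_two_mul_div_mul_pow {x : ℝ} (hx : |x| < 1) :
    HasSum (fun n : ℕ ↦ ((2 * (n + 1)).centralBinom : ℝ) / 16 ^ (n + 1) / (n + 1) *
        x ^ (2 * (n + 1)))
      (4 * log 2 - 2 * log (1 + √(1 - x)) - 2 * log (1 + √(1 + x))) := by
  have h := (hasSum_centralBinom_div_mul_pow hx).add
    (hasSum_centralBinom_div_mul_pow (x := -x) (by rwa [abs_neg]))
  have hinj : Function.Injective fun n : ℕ ↦ 2 * n + 1 := fun a b h ↦ by simpa using h
  rw [← hinj.hasSum_iff] at h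
  · convert h using 1
    · ext n
      have h4 : (4 : ℝ) ^ (2 * (n + 1)) = 16 ^ (n + 1) := by rw [pow_mul]; norm_num
      simp only [Function.comp, show 2 * n + 1 + 1 = 2 * (n + 1) by ring,
        (even_two_mul (n + 1)).neg_pow, h4]
      push_cast
      field_simp
      ring
    · rw [sub_neg_eq_add]; ring
  · intro n hn
    have hodd : Odd (n + 1) := by
      by_contra hne
      obtain ⟨k, hk⟩ := Nat.not_odd_iff_even.1 hne
      exact hn ⟨k - 1, by dsimp only; omega⟩
    rw [hodd.neg_pow]
    ring

theorem hasSum_integral_log_one_add_sqrt_two_mul :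
    HasSum (fun n : ℕ ↦ ((2 * (n + 1)).centralBinom : ℝ) / 16 ^ (n + 1) / (n + 1) *
        (π / 2 * ((n + 1).centralBinom / 4 ^ (n + 1))))
      (∫ t in (0 : ℝ)..π / 2,
        (4 * log 2 - 2 * log (1 + √2 * sin (t / 2)) - 2 * log (1 + √2 * cos (t / 2)))) := by
  have hpi := Real.pi_pos
  have hIoc : Set.uIoc 0 (π / 2) = Set.Ioc 0 (π / 2) := Set.uIoc_of_le (by positivity)
  have hlim (t : ℝ) (ht : t ∈ Set.uIoc 0 (π / 2)) :
      HasSum (fun n : ℕ ↦ ((2 * (n + 1)).centralBinom : ℝ) / 16 ^ (n + 1) / (n + 1) *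
        cos t ^ (2 * (n + 1)))
      (4 * log 2 - 2 * log (1 + √2 * sin (t / 2)) - 2 * log (1 + √2 * cos (t / 2))) := by
    rw [hIoc] at ht
    have h0 : 0 ≤ cos t := cos_nonneg_of_mem_Icc ⟨by linarith [ht.1], ht.2⟩
    have hs : 0 ≤ sin (t / 2) :=
      sin_nonneg_of_nonneg_of_le_pi (by linarith [ht.1]) (by linarith [ht.2])
    have hc : 0 ≤ cos (t / 2) :=
      cos_nonneg_of_mem_Icc ⟨by linarith [ht.1], by linarith [ht.2]⟩
    have h1 : cos t < 1 := by
      simpa using cos_lt_cos_of_nonneg_of_le_pi_div_two le_rfl ht.2 ht.1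
    have hcos : cos t = 2 * cos (t / 2) ^ 2 - 1 := by rw [← cos_two_mul]; congr 1; ring
    have hsqrt1 : √(1 - cos t) = √2 * sin (t / 2) := by
      rw [← Real.sqrt_sq hs, ← Real.sqrt_mul (by norm_num), sin_sq, hcos]
      congr 1; ring
    have hsqrt2 : √(1 + cos t) = √2 * cos (t / 2) := by
      rw [← Real.sqrt_sq hc, ← Real.sqrt_mul (by norm_num), hcos]
      congr 1; ring_nf
    rw [← hsqrt1, ← hsqrt2]
    exact hasSum_centralBinom_two_mul_div_mul_pow (by rwa [abs_of_nonneg h0])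
  have hcont : ContinuousOn
      (fun t ↦ 4 * log 2 - 2 * log (1 + √2 * sin (t / 2)) - 2 * log (1 + √2 * cos (t / 2)))
      (Set.uIcc 0 (π / 2)) := by
    rw [Set.uIcc_of_le (by positivity)]
    have h1 : ∀ t ∈ Set.Icc 0 (π / 2), 1 + √2 * sin (t / 2) ≠ 0 := fun t ht ↦ by
      have : 0 ≤ sin (t / 2) :=
        sin_nonneg_of_nonneg_of_le_pi (by linarith [ht.1]) (by linarith [ht.2])
      positivity
    have h2 : ∀ t ∈ Set.Icc 0 (π / 2), 1 + √2 * cos (t / 2) ≠ 0 := fun t ht ↦ by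
      have : 0 ≤ cos (t / 2) :=
        cos_nonneg_of_mem_Icc ⟨by linarith [ht.1], by linarith [ht.2]⟩
      positivity
    fun_prop (disch := assumption)
  have h := intervalIntegral.hasSum_integral_of_dominated_convergence
    (μ := MeasureTheory.volume) (a := 0) (b := π / 2)
    (F := fun (n : ℕ) t ↦ ((2 * (n + 1)).centralBinom : ℝ) / 16 ^ (n + 1) / (n + 1) *
        cos t ^ (2 * (n + 1)))
    (fun (n : ℕ) t ↦ ((2 * (n + 1)).centralBinom : ℝ) / 16 ^ (n + 1) / (n + 1) *
        cos t ^ (2 * (n + 1)))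
    (fun n ↦ by fun_prop)
    (fun n ↦ .of_forall fun t _ ↦ by
      rw [Real.norm_of_nonneg]
      have := (even_two_mul (n + 1)).pow_nonneg (cos t)
      positivity)
    (.of_forall fun t ht ↦ (hlim t ht).summable)
    (hcont.intervalIntegrable.congr fun t ht ↦ (hlim t ht).tsum_eq.symm)
    (.of_forall hlim)
  simpa only [intervalIntegral.integral_const_mul, integral_cos_pow_two_mul] using h

theorem integral_log_one_add_sqrt_two_mul_sin :
    ∫ u in (0 : ℝ)..π / 2, log (1 + √2 * sin u) =
      3 * π / 4 * log 2 + 2 * ∫ v in (π / 8)..(5 * π / 8), log (sin v) := by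
  have hpi := Real.pi_pos
  have hint (a b : ℝ) : IntervalIntegrable (fun x ↦ log (sin x)) MeasureTheory.volume a b :=
    intervalIntegrable_log_sin
  have hcomp (c : ℝ) : IntervalIntegrable (fun u ↦ log (sin (u / 2 + c)))
      MeasureTheory.volume 0 (π / 2) := by
    have h : IntervalIntegrable (fun x ↦ log (sin (x + c))) MeasureTheory.volume 0 (π / 4) := by
      simpa using (hint (0 + c) (π / 4 + c)).comp_add_right c
    have h' := h.comp_mul_left (c := 1 / 2)
    simp only [one_div_mul_eq_div] at h'
    convert h' using 1 <;> ring
  have hval (c : ℝ) : ∫ u in (0 : ℝ)..π / 2, log (sin (u / 2 + c)) =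
      2 * ∫ v in c..(π / 4 + c), log (sin v) := by
    rw [intervalIntegral.integral_comp_div_add (fun v ↦ log (sin v)) two_ne_zero, smul_eq_mul]
    congr 2 <;> ring
  have hcongr : ∫ u in (0 : ℝ)..π / 2, log (1 + √2 * sin u) =
      ∫ u in (0 : ℝ)..π / 2,
        (3 / 2 * log 2 + log (sin (u / 2 + π / 8)) + log (sin (u / 2 + 3 * π / 8))) := by
    refine intervalIntegral.integral_congr fun u hu ↦ ?_
    rw [Set.uIcc_of_le (by positivity)] at hu
    have h1 : 0 < sin (u / 2 + π / 8) :=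
      sin_pos_of_pos_of_lt_pi (by linarith [hu.1]) (by linarith [hu.2])
    have h2 : 0 < sin (u / 2 + 3 * π / 8) :=
      sin_pos_of_pos_of_lt_pi (by linarith [hu.1]) (by linarith [hu.2])
    have h3 : sin (u / 2 + 3 * π / 8) = cos (u / 2 - π / 8) := by
      rw [← sin_add_pi_div_two]; congr 1; ring
    have hq : √2 ^ 2 = (2 : ℝ) := Real.sq_sqrt (by norm_num)
    have h4 : 1 + √2 * sin u =
        2 * √2 * sin (u / 2 + π / 8) * sin (u / 2 + 3 * π / 8) := by
      have h5 : sin u + sin (π / 4) = 2 * sin (u / 2 + π / 8) * cos (u / 2 - π / 8) := by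
        rw [two_mul_sin_mul_cos, add_comm]; congr 2 <;> ring
      rw [sin_pi_div_four] at h5
      rw [h3]
      linear_combination √2 * h5 - hq / 2
    have h6 : log (2 * √2) = 3 / 2 * log 2 := by
      rw [log_mul (by norm_num) (by positivity), log_sqrt (by norm_num)]; ring
    rw [h4, log_mul (by positivity) h2.ne', log_mul (by positivity) h1.ne', h6]
  rw [hcongr, intervalIntegral.integral_add (intervalIntegrable_const.add (hcomp _))
    (by simpa only [mul_div_assoc] using hcomp (3 * π / 8)),
    intervalIntegral.integral_add intervalIntegrable_const (hcomp _),
    intervalIntegral.integral_const, hval, hval,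
    ← intervalIntegral.integral_add_adjacent_intervals (hint (π / 8) (3 * π / 8))
      (hint (3 * π / 8) (5 * π / 8)), show π / 4 + π / 8 = 3 * π / 8 by ring,
    show π / 4 + 3 * π / 8 = 5 * π / 8 by ring, smul_eq_mul]
  ring

theorem integral_log_sin_pi_div_eight_five_pi_div_eight :
    ∫ v in (π / 8)..(5 * π / 8), log (sin v) =
      -(π / 2 * log 2) - ∫ x in (0 : ℝ)..π / 8, (log (sin x) - log (cos x)) := by
  have hint (a b : ℝ) : IntervalIntegrable (fun x ↦ log (sin x)) MeasureTheory.volume a b :=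
    intervalIntegrable_log_sin
  have hint' (a b : ℝ) : IntervalIntegrable (fun x ↦ log (cos x)) MeasureTheory.volume a b :=
    intervalIntegrable_log_cos
  have h1 : ∫ v in (π / 2)..(5 * π / 8), log (sin v) = ∫ x in (0 : ℝ)..π / 8, log (cos x) := by
    simp_rw [← sin_add_pi_div_two]
    rw [intervalIntegral.integral_comp_add_right (fun v ↦ log (sin v))]
    congr 1 <;> ring
  have h2 := intervalIntegral.integral_add_adjacent_intervals (hint 0 (π / 8))
    (hint (π / 8) (π / 2))
  rw [integral_log_sin_zero_pi_div_two] at h2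
  rw [intervalIntegral.integral_sub (hint _ _) (hint' _ _), ← h1,
    ← intervalIntegral.integral_add_adjacent_intervals (hint (π / 8) (π / 2))
      (hint (π / 2) (5 * π / 8))]
  linarith

theorem hasDerivAt_inverse_tangent_integral {t : ℝ} (ht : |t| < 1) (ht0 : t ≠ 0) :
    HasDerivAt (fun t : ℝ ↦ ∑' k : ℕ, (-1) ^ k * t ^ (2 * k + 1) / (2 * (k : ℝ) + 1) ^ 2)
      (arctan t / t) t := by
  have hball {r y : ℝ} : y ∈ Metric.ball (0 : ℝ) r ↔ |y| < r := by simp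
  obtain ⟨r, htr, hr1⟩ := exists_between ht
  have hr0 : 0 < r := (abs_nonneg t).trans_lt htr
  have hgeom : Summable fun k : ℕ ↦ (r ^ 2) ^ k :=
    summable_geometric_of_lt_one (by positivity) (pow_lt_one₀ hr0.le hr1 two_ne_zero)
  refine (hasDerivAt_tsum_of_isPreconnected hgeom Metric.isOpen_ball
    (convex_ball (0 : ℝ) r).isPreconnected
    (g := fun (k : ℕ) (t : ℝ) ↦ (-1) ^ k * t ^ (2 * k + 1) / (2 * (k : ℝ) + 1) ^ 2)
    (g' := fun (k : ℕ) (t : ℝ) ↦ (-1) ^ k * t ^ (2 * k) / (2 * (k : ℝ) + 1))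
    (fun k y _ ↦ ?_) (fun k y hy ↦ ?_) (Metric.mem_ball_self hr0) (by simp)
    (hball.2 htr)).congr_deriv ?_
  · refine (((hasDerivAt_pow (2 * k + 1) y).const_mul ((-1) ^ k)).div_const _).congr_deriv ?_
    push_cast
    field_simp
  · rw [norm_div, norm_mul, norm_pow, norm_neg, norm_one, one_pow, one_mul, norm_pow, ← pow_mul]
    have h1 : 1 ≤ ‖2 * (k : ℝ) + 1‖ := by
      rw [Real.norm_of_nonneg (by positivity)]
      linarith [Nat.cast_nonneg (α := ℝ) k]
    calc ‖y‖ ^ (2 * k) / ‖2 * (k : ℝ) + 1‖ ≤ ‖y‖ ^ (2 * k) := div_le_self (by positivity) h1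
      _ ≤ r ^ (2 * k) := pow_le_pow_left₀ (norm_nonneg _) (hball.1 hy).le _
  · rw [← ((Real.hasSum_arctan ht).div_const t).tsum_eq]
    refine tsum_congr fun k ↦ ?_
    push_cast
    rw [pow_succ t]
    field_simp

theorem continuousOn_mul_log_sin : ContinuousOn (fun x : ℝ ↦ x * log (sin x)) (Set.Ico 0 π) := by
  have hsinc : ∀ x ∈ Set.Ico 0 π, sinc x ≠ 0 := fun x hx ↦ by
    rcases eq_or_ne x 0 with rfl | h0
    · simp
    · rw [sinc_of_ne_zero h0]
      exact div_ne_zero (sin_pos_of_pos_of_lt_pi (hx.1.lt_of_ne' h0) hx.2).ne' h0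
  have h : ContinuousOn (fun x : ℝ ↦ x * log x + x * log (sinc x)) (Set.Ico 0 π) :=
    continuous_mul_log.continuousOn.add
      (continuousOn_id.mul (continuous_sinc.continuousOn.log hsinc))
  refine h.congr fun x hx ↦ ?_
  rcases eq_or_ne x 0 with rfl | h0
  · simp
  · have h1 := hsinc x hx
    dsimp only
    rw [← mul_add, ← log_mul h0 h1, sinc_of_ne_zero h0, mul_div_cancel₀ _ h0]

theorem tan_pi_div_eight : tan (π / 8) = √2 - 1 := by
  have h1 := sin_two_mul (π / 8)
  have h2 := cos_sq (π / 8)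
  rw [show 2 * (π / 8) = π / 4 by ring] at h1 h2
  rw [sin_pi_div_four] at h1
  rw [cos_pi_div_four] at h2
  have hc : 0 < cos (π / 8) :=
    cos_pos_of_mem_Ioo ⟨by linarith [pi_pos], by linarith [pi_pos]⟩
  have hq : √2 ^ 2 = (2 : ℝ) := Real.sq_sqrt (by norm_num)
  rw [tan_eq_sin_div_cos, div_eq_iff hc.ne']
  apply mul_right_cancel₀ hc.ne'
  linear_combination -h1 / 2 - (√2 - 1) * h2 - hq / 4

theorem integral_log_tan_pi_div_eight :
    ∫ x in (0 : ℝ)..π / 8, (log (sin x) - log (cos x)) =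
      -(π / 8 * log (1 + √2)) - imLi2 := by
  have hpi := pi_pos
  have hsin {x : ℝ} (hx : x ∈ Set.Ioc 0 (π / 8)) : 0 < sin x :=
    sin_pos_of_pos_of_lt_pi hx.1 (by linarith [hx.2])
  have hcos {x : ℝ} (hx : x ∈ Set.Icc 0 (π / 8)) : 0 < cos x :=
    cos_pos_of_mem_Ioo ⟨by linarith [hx.1], by linarith [hx.2]⟩
  have htan {x : ℝ} (hx : x ∈ Set.Icc 0 (π / 8)) : |tan x| < 1 := by
    rw [abs_of_nonneg (tan_nonneg_of_nonneg_of_le_pi_div_two hx.1 (by linarith [hx.2])),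
      ← tan_pi_div_four]
    exact tan_lt_tan_of_lt_of_lt_pi_div_two (by linarith [hx.1]) (by linarith)
      (by linarith [hx.2])
  set T : ℝ → ℝ := fun t ↦ ∑' k : ℕ, (-1) ^ k * t ^ (2 * k + 1) / (2 * (k : ℝ) + 1) ^ 2 with hT
  have hTcont : ContinuousOn T (Set.Icc 0 (tan (π / 8))) := by
    have ht := htan ⟨by positivity, le_rfl⟩
    have ht0 : 0 ≤ tan (π / 8) :=
      tan_nonneg_of_nonneg_of_le_pi_div_two (by positivity) (by linarith)
    rw [abs_of_nonneg ht0] at ht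
    refine continuousOn_tsum (u := fun k ↦ tan (π / 8) ^ k) (fun k ↦ by fun_prop)
      (summable_geometric_of_lt_one ht0 ht) fun k y hy ↦ ?_
    rw [norm_div, norm_mul, norm_pow, norm_neg, norm_one, one_pow, one_mul, norm_pow,
      Real.norm_of_nonneg hy.1, Real.norm_of_nonneg (by positivity)]
    have h1 : 1 ≤ (2 * (k : ℝ) + 1) ^ 2 :=
      one_le_pow₀ (by linarith [Nat.cast_nonneg (α := ℝ) k])
    calc y ^ (2 * k + 1) / (2 * (k : ℝ) + 1) ^ 2 ≤ y ^ (2 * k + 1) :=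
          div_le_self (pow_nonneg hy.1 _) h1
      _ ≤ y ^ k := pow_le_pow_of_le_one hy.1 (hy.2.trans ht.le) (by omega)
      _ ≤ tan (π / 8) ^ k := pow_le_pow_left₀ hy.1 hy.2 k
  have hcont : ContinuousOn (fun x ↦ x * log (sin x) - x * log (cos x) - T (tan x))
      (Set.Icc 0 (π / 8)) := by
    refine ((continuousOn_mul_log_sin.mono fun x hx ↦ ⟨hx.1, by linarith [hx.2]⟩).sub
      (continuousOn_id.mul (continuous_cos.continuousOn.log fun x hx ↦ (hcos hx).ne'))).sub
      (hTcont.comp (fun x hx ↦ (continuousAt_tan.2 (hcos hx).ne').continuousWithinAt)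
        fun x hx ↦ ⟨?_, ?_⟩)
    · exact tan_nonneg_of_nonneg_of_le_pi_div_two hx.1 (by linarith [hx.2])
    · exact strictMonoOn_tan.monotoneOn ⟨by linarith [hx.1], by linarith [hx.2]⟩
        ⟨by linarith, by linarith⟩ hx.2
  have hderiv : ∀ x ∈ Set.Ioo 0 (π / 8),
      HasDerivAt (fun x ↦ x * log (sin x) - x * log (cos x) - T (tan x))
        (log (sin x) - log (cos x)) x := fun x hx ↦ by
    have hs := hsin ⟨hx.1, hx.2.le⟩
    have hc := hcos ⟨hx.1.le, hx.2.le⟩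
    have ht0 : tan x ≠ 0 := by rw [tan_eq_sin_div_cos]; positivity
    have h1 := (hasDerivAt_id' x).mul ((hasDerivAt_sin x).log hs.ne')
    have h2 := (hasDerivAt_id' x).mul ((hasDerivAt_cos x).log hc.ne')
    have h3 := (hasDerivAt_inverse_tangent_integral (htan ⟨hx.1.le, hx.2.le⟩) ht0).comp x
      (hasDerivAt_tan hc.ne')
    refine ((h1.sub h2).sub h3).congr_deriv ?_
    rw [arctan_tan (by linarith [hx.1]) (by linarith [hx.2]), tan_eq_sin_div_cos]
    field_simp
    linear_combination x * sin_sq_add_cos_sq x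
  have hint : IntervalIntegrable (fun x ↦ log (sin x) - log (cos x)) MeasureTheory.volume
      0 (π / 8) :=
    IntervalIntegrable.sub (f := fun x ↦ log (sin x)) (g := fun x ↦ log (cos x))
      intervalIntegrable_log_sin intervalIntegrable_log_cos
  rw [intervalIntegral.integral_eq_sub_of_hasDerivAt_of_le (by positivity) hcont hderiv hint]
  have hmem : π / 8 ∈ Set.Ioc 0 (π / 8) := ⟨by positivity, le_rfl⟩
  have hlog : log (sin (π / 8)) - log (cos (π / 8)) = -log (1 + √2) := by
    rw [← log_div (hsin hmem).ne' (hcos ⟨hmem.1.le, le_rfl⟩).ne', ← tan_eq_sin_div_cos,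
      tan_pi_div_eight, ← log_inv]
    congr 1
    have hq : √2 ^ 2 = (2 : ℝ) := Real.sq_sqrt (by norm_num)
    apply eq_inv_of_mul_eq_one_left
    linear_combination hq
  have hT0 : T 0 = 0 := by simp [hT]
  have hT8 : T (tan (π / 8)) = imLi2 := by rw [tan_pi_div_eight]; rfl
  rw [hT8, tan_zero, hT0]
  linear_combination π / 8 * hlog

theorem integral_log_add_log_eq_integral_log_one_add_sqrt_two_mul_sin :
    ∫ t in (0 : ℝ)..π / 2,
        (4 * log 2 - 2 * log (1 + √2 * sin (t / 2)) - 2 * log (1 + √2 * cos (t / 2))) =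
      2 * π * log 2 - 4 * ∫ u in (0 : ℝ)..π / 2, log (1 + √2 * sin u) := by
  have hpi := pi_pos
  have hcont : ContinuousOn (fun u ↦ log (1 + √2 * sin u)) (Set.Icc 0 (π / 2)) := by
    have h1 : ∀ u ∈ Set.Icc 0 (π / 2), 1 + √2 * sin u ≠ 0 := fun u hu ↦ by
      have := sin_nonneg_of_nonneg_of_le_pi hu.1 (by linarith [hu.2])
      positivity
    fun_prop (disch := assumption)
  have hint {a b : ℝ} (ha : a ∈ Set.Icc 0 (π / 2)) (hb : b ∈ Set.Icc 0 (π / 2)) :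
      IntervalIntegrable (fun u ↦ log (1 + √2 * sin u)) MeasureTheory.volume a b :=
    (hcont.mono (Set.uIcc_subset_Icc ha hb)).intervalIntegrable
  have h0 : (0 : ℝ) ∈ Set.Icc 0 (π / 2) := ⟨le_rfl, by positivity⟩
  have h4 : π / 4 ∈ Set.Icc 0 (π / 2) := ⟨by positivity, by linarith⟩
  have h2 : π / 2 ∈ Set.Icc 0 (π / 2) := ⟨by positivity, le_rfl⟩
  have hs : ContinuousOn (fun t ↦ log (1 + √2 * sin (t / 2))) (Set.uIcc 0 (π / 2)) := by
    rw [Set.uIcc_of_le (by positivity)]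
    exact hcont.comp (by fun_prop) fun t ht ↦ ⟨by linarith [ht.1], by linarith [ht.2]⟩
  have hcos (t : ℝ) : cos (t / 2) = sin (π / 2 - t / 2) := (sin_pi_div_two_sub _).symm
  have hc : ContinuousOn (fun t ↦ log (1 + √2 * sin (π / 2 - t / 2))) (Set.uIcc 0 (π / 2)) := by
    rw [Set.uIcc_of_le (by positivity)]
    exact hcont.comp (f := fun t ↦ π / 2 - t / 2) (by fun_prop)
      fun t ht ↦ ⟨by linarith [ht.2], by linarith [ht.1]⟩
  simp_rw [hcos]
  rw [intervalIntegral.integral_sub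
      (intervalIntegrable_const.sub (hs.intervalIntegrable.const_mul 2))
      (hc.intervalIntegrable.const_mul 2),
    intervalIntegral.integral_sub intervalIntegrable_const (hs.intervalIntegrable.const_mul 2),
    intervalIntegral.integral_const, intervalIntegral.integral_const_mul,
    intervalIntegral.integral_const_mul,
    intervalIntegral.integral_comp_div (fun u ↦ log (1 + √2 * sin u)) two_ne_zero,
    intervalIntegral.integral_comp_sub_div (fun u ↦ log (1 + √2 * sin u)) two_ne_zero,
    ← intervalIntegral.integral_add_adjacent_intervals (hint h0 h4) (hint h4 h2)]
  rw [zero_div, sub_zero, show π / 2 / 2 = π / 4 by ring, show π / 2 - π / 4 = π / 4 by ring]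
  simp only [smul_eq_mul]
  ring

/-- `∑_{n=1}^∞ C(4n,2n) C(2n,n) / (n 64^n) = 6 ln 2 - 2 ln(1+√2) - (16/π) Im Li₂((√2-1)i)`. -/
theorem binom4n2n_over_n_series :
    ∑' n : ℕ, ((4*(n+1)).choose (2*(n+1)) : ℝ) * ((2*(n+1)).choose (n+1) : ℝ) /
        (((n:ℝ) + 1) * 64 ^ (n+1))
      = 6 * Real.log 2 - 2 * Real.log (1 + Real.sqrt 2) - (16 / π) * imLi2 := by
  have h := hasSum_integral_log_one_add_sqrt_two_mul.mul_left (2 / π)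
  rw [integral_log_add_log_eq_integral_log_one_add_sqrt_two_mul_sin,
    integral_log_one_add_sqrt_two_mul_sin, integral_log_sin_pi_div_eight_five_pi_div_eight,
    integral_log_tan_pi_div_eight] at h
  have hpi := pi_ne_zero
  convert h.tsum_eq using 1
  · refine tsum_congr fun n ↦ ?_
    rw [show 4 * (n + 1) = 2 * (2 * (n + 1)) by ring, ← Nat.centralBinom_eq_two_mul_choose,
      ← Nat.centralBinom_eq_two_mul_choose, show (64 : ℝ) = 16 * 4 by norm_num, mul_pow]
    field_simp
  · field_simp
    ring
end

section
/- The series ∑_{n=0}^∞ C(2n,n)² · (2n+1) / (16^n · (n+1)⁴) equals 16 - 6π² - 32 ln 2 + 24 ln²2 + (64G - 32 + 256 · Im Li₃((1+i)/2))/π. -/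
open Real

/-- Catalan's constant `G = ∑_{n=0}^∞ (-1)^n/(2n+1)²`. -/
noncomputable def catalanG : ℝ := ∑' n : ℕ, (-1) ^ n / (2 * (n:ℝ) + 1)^2

/-- The imaginary part of `Li₃((1+i)/2)`, given explicitly by the series
`∑_{k=1}^∞ sin(kπ/4) / (2^{k/2} k³)`. -/
noncomputable def imLi3 : ℝ :=
  ∑' k : ℕ, Real.sin (((k:ℝ) + 1) * π / 4) /
    ((2:ℝ) ^ (((k:ℝ) + 1) / 2) * ((k:ℝ) + 1)^3)

/-- The polylogarithm `Liₖ(z) = ∑_{n ≥ 1} zⁿ / nᵏ`. -/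
noncomputable def polylog (k : ℕ) (z : ℂ) : ℂ := ∑' n : ℕ, z ^ (n + 1) / ((n : ℂ) + 1) ^ k

lemma summable_one_div_nat_succ_pow {k : ℕ} (hk : 2 ≤ k) :
    Summable fun n : ℕ => 1 / ((n : ℝ) + 1) ^ k := by
  have h := (summable_nat_add_iff 1).2 (Real.summable_one_div_nat_pow.2 (show 1 < k by omega))
  simpa using h

lemma norm_polylog_term_le (k n : ℕ) {z : ℂ} (hz : ‖z‖ ≤ 1) :
    ‖z ^ (n + 1) / ((n : ℂ) + 1) ^ k‖ ≤ 1 / ((n : ℝ) + 1) ^ k := by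
  have h : ‖(n : ℂ) + 1‖ = (n : ℝ) + 1 := by
    rw [← Nat.cast_succ, Complex.norm_natCast, Nat.cast_succ]
  rw [norm_div, norm_pow, norm_pow, h]
  gcongr
  exact pow_le_one₀ (norm_nonneg _) hz

lemma summable_polylog {k : ℕ} (hk : 2 ≤ k) {z : ℂ} (hz : ‖z‖ ≤ 1) :
    Summable fun n : ℕ => z ^ (n + 1) / ((n : ℂ) + 1) ^ k :=
  .of_norm_bounded (summable_one_div_nat_succ_pow hk) fun n => norm_polylog_term_le k n hz

lemma continuousOn_polylog {k : ℕ} (hk : 2 ≤ k) :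
    ContinuousOn (polylog k) (Metric.closedBall 0 1) := by
  refine continuousOn_tsum (fun n => by fun_prop) (summable_one_div_nat_succ_pow hk) ?_
  intro n z hz
  exact norm_polylog_term_le k n (by simpa using hz)

lemma polylog_one {z : ℂ} (hz : ‖z‖ < 1) : polylog 1 z = -Complex.log (1 - z) := by
  have h := (hasSum_nat_add_iff' 1).2 (Complex.hasSum_taylorSeries_neg_log hz)
  simpa [polylog] using h.tsum_eq

lemma polylog_zero_right (k : ℕ) : polylog k 0 = 0 := by simp [polylog]

lemma hasDerivAt_polylog_succ (k : ℕ) {z : ℂ} (hz₀ : z ≠ 0) (hz : ‖z‖ < 1) :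
    HasDerivAt (polylog (k + 1)) (polylog k z / z) z := by
  obtain ⟨r, hzr, hr⟩ := exists_between hz
  have hr₀ : 0 ≤ r := (norm_nonneg z).trans hzr.le
  have key : HasDerivAt (polylog (k + 1)) (∑' n : ℕ, z ^ n / ((n : ℂ) + 1) ^ k) z := by
    refine hasDerivAt_tsum_of_isPreconnected (t := Metric.ball 0 r) (y₀ := 0)
      (u := fun n => r ^ n) (g := fun (n : ℕ) (y : ℂ) => y ^ (n + 1) / ((n : ℂ) + 1) ^ (k + 1))
      (g' := fun n y => y ^ n / ((n : ℂ) + 1) ^ k)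
      (summable_geometric_of_lt_one hr₀ hr) Metric.isOpen_ball
      (convex_ball _ _).isPreconnected ?_ ?_ (Metric.mem_ball_self ((norm_nonneg z).trans_lt hzr))
      (by simp [summable_zero]) (by simpa using hzr)
    · intro n y _
      have hn : (n : ℂ) + 1 ≠ 0 := Nat.cast_add_one_ne_zero n
      refine ((hasDerivAt_pow (n + 1) y).div_const (((n : ℂ) + 1) ^ (k + 1))).congr_deriv ?_
      rw [Nat.add_sub_cancel, Nat.cast_succ, pow_succ, mul_comm (((n : ℂ) + 1) ^ k),
        mul_div_mul_left _ _ hn]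
    · intro n y hy
      have hy' : ‖y‖ ≤ r := by simpa using (Metric.mem_ball.1 hy).le
      have h : ‖(n : ℂ) + 1‖ = (n : ℝ) + 1 := by
        rw [← Nat.cast_succ, Complex.norm_natCast, Nat.cast_succ]
      rw [norm_div, norm_pow, norm_pow, h]
      calc ‖y‖ ^ n / ((n : ℝ) + 1) ^ k ≤ ‖y‖ ^ n / 1 := by
            gcongr
            exact one_le_pow₀ (by linarith [n.cast_nonneg (α := ℝ)])
        _ ≤ r ^ n := by rw [div_one]; gcongr
  convert key using 1
  rw [polylog, ← tsum_div_const]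
  congr 1 with n
  field_simp
  ring

lemma polylog_conj (k : ℕ) (z : ℂ) :
    polylog k ((starRingEnd ℂ) z) = (starRingEnd ℂ) (polylog k z) := by
  rw [polylog, polylog, Complex.conj_tsum]
  simp

lemma polylog_ofReal_im (k : ℕ) (x : ℝ) : (polylog k x).im = 0 := by
  rw [← Complex.conj_eq_iff_im, ← polylog_conj, Complex.conj_ofReal]

open Complex in
lemma log_one_add_ofReal_mul_I (y : ℝ) :
    Complex.log (1 + y * I) = (Real.log (1 + y ^ 2) / 2 : ℝ) + (Real.arctan y : ℝ) * I := by
  have hn : ‖(1 + y * I : ℂ)‖ = √(1 + y ^ 2) := by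
    rw [Complex.norm_def, Complex.normSq_apply]
    congr 1
    simp
    ring
  apply Complex.ext
  · rw [Complex.log_re, hn, Real.log_sqrt (by positivity)]
    simp [-Complex.ofReal_arctan]
  · rw [Complex.log_im, Complex.arg_of_re_nonneg (by simp), hn, Real.arctan_eq_arcsin]
    simp

open Complex in
lemma log_one_sub_ofReal_mul_I (y : ℝ) :
    Complex.log (1 - y * I) = (Real.log (1 + y ^ 2) / 2 : ℝ) - (Real.arctan y : ℝ) * I := by
  have h := log_one_add_ofReal_mul_I (-y)
  simp only [Complex.ofReal_neg, neg_mul, Real.arctan_neg, neg_sq, ← sub_eq_add_neg] at h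
  exact h

lemma log_inv_one_add_ofReal_mul_I (y : ℝ) :
    Complex.log (1 + y * Complex.I)⁻¹ =
      -((Real.log (1 + y ^ 2) / 2 : ℝ) + (Real.arctan y : ℝ) * Complex.I) := by
  rw [Complex.log_inv, log_one_add_ofReal_mul_I]
  have h : 0 < (1 + y * Complex.I : ℂ).re := by simp
  exact fun h' => (Complex.arg_eq_pi_iff.1 h').1.not_ge h.le

lemma log_half_mul_one_sub_ofReal_mul_I (y : ℝ) :
    Complex.log ((1 - y * Complex.I) / 2) =
      (Real.log (1 + y ^ 2) / 2 - Real.log 2 : ℝ) - (Real.arctan y : ℝ) * Complex.I := by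
  have h : (1 - y * Complex.I : ℂ) ≠ 0 := fun h => by simpa using congrArg Complex.re h
  have h2 := Complex.log_ofReal_mul (r := 1 / 2) (by norm_num) h
  rw [log_one_sub_ofReal_mul_I] at h2
  rw [show (1 - y * Complex.I : ℂ) / 2 = ((1 / 2 : ℝ) : ℂ) * (1 - y * Complex.I) by
    push_cast; ring, h2, one_div, Real.log_inv]
  push_cast
  ring

lemma hasSum_alternating_one_div_sq :
    HasSum (fun n : ℕ => (-1 : ℝ) ^ n / ((n : ℝ) + 1) ^ 2) (π ^ 2 / 12) := by
  have h : HasSum (fun n : ℕ => 1 / ((n : ℝ) + 1) ^ 2) (π ^ 2 / 6) := by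
    have := (hasSum_nat_add_iff' 1).2 hasSum_zeta_two
    simpa using this
  have hodd : HasSum (fun n : ℕ => 1 / (((2 * n + 1 : ℕ) : ℝ) + 1) ^ 2) (π ^ 2 / 6 / 4) := by
    refine ((h.div_const 4)).congr_fun fun n => ?_
    push_cast
    rw [show (2 * (n : ℝ) + 1 + 1) = 2 * (n + 1) by ring]
    field_simp
    norm_num
  have heven : HasSum (fun n : ℕ => 1 / (((2 * n : ℕ) : ℝ) + 1) ^ 2) (π ^ 2 / 8) := by
    have hs : Summable fun n : ℕ => 1 / (((2 * n : ℕ) : ℝ) + 1) ^ 2 :=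
      h.summable.comp_injective (i := fun n => 2 * n) (mul_right_injective₀ two_ne_zero)
    have := (hs.hasSum.even_add_odd (f := fun n : ℕ => 1 / ((n : ℝ) + 1) ^ 2) hodd).unique h
    convert hs.hasSum using 1
    linarith
  convert HasSum.even_add_odd (f := fun n : ℕ => (-1 : ℝ) ^ n / ((n : ℝ) + 1) ^ 2)
    (m := π ^ 2 / 8) (m' := -(π ^ 2 / 6 / 4)) ?_ ?_ using 1
  · ring
  · simpa using heven
  · simpa [pow_succ, neg_div] using hodd.neg

lemma polylog_two_neg_I :
    polylog 2 (-Complex.I) = (-(π ^ 2 / 48) : ℝ) - catalanG * Complex.I := by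
  have he : HasSum (fun n : ℕ => (-Complex.I) ^ (2 * n + 1) / (((2 * n : ℕ) : ℂ) + 1) ^ 2)
      (-(catalanG * Complex.I)) := by
    have hs : Summable fun n : ℕ => (-1 : ℝ) ^ n / (2 * (n : ℝ) + 1) ^ 2 := by
      refine .of_norm_bounded (summable_one_div_nat_succ_pow le_rfl) fun n => ?_
      rw [norm_div, norm_pow, norm_neg, norm_one, one_pow, Real.norm_of_nonneg (by positivity)]
      gcongr
      linarith [n.cast_nonneg (α := ℝ)]
    have h := (Complex.hasSum_ofReal.2 hs.hasSum).mul_right (-Complex.I)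
    rw [← catalanG, mul_neg] at h
    refine (h).congr_fun fun n => ?_
    rw [pow_succ, pow_mul, neg_sq, Complex.I_sq]
    push_cast
    ring
  have ho : HasSum (fun n : ℕ => (-Complex.I) ^ (2 * n + 1 + 1) / (((2 * n + 1 : ℕ) : ℂ) + 1) ^ 2)
      ((-(π ^ 2 / 48) : ℝ) : ℂ) := by
    have h := Complex.hasSum_ofReal.2 (hasSum_alternating_one_div_sq.mul_left (-(1 / 4)))
    rw [show -(1 / 4) * (π ^ 2 / 12) = -(π ^ 2 / 48) by ring] at h
    refine (h).congr_fun fun n => ?_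
    have hn : (n : ℂ) + 1 ≠ 0 := Nat.cast_add_one_ne_zero n
    rw [show 2 * n + 1 + 1 = 2 * (n + 1) by ring, pow_mul, neg_sq, Complex.I_sq, pow_succ]
    push_cast
    rw [show (2 * (n : ℂ) + 1 + 1) = 2 * (n + 1) by ring]
    field_simp
    ring
  have h := he.even_add_odd
    (f := fun n : ℕ => (-Complex.I) ^ (n + 1) / ((n : ℂ) + 1) ^ 2) ho
  rw [polylog, h.tsum_eq]
  ring

lemma im_polylog_three_half_one_sub_I :
    (polylog 3 ((1 - Complex.I) / 2)).im = -imLi3 := by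
  have hw : (1 - Complex.I) / 2 = (starRingEnd ℂ) ((1 + Complex.I) / 2) := by
    simp [sub_eq_add_neg, Complex.conj_ofNat]
  have hexp : (1 + Complex.I) / 2 =
      ((2 : ℝ) ^ (-(1 / 2) : ℝ) : ℝ) * Complex.exp ((π / 4 : ℝ) * Complex.I) := by
    have h2 : (2 : ℝ) ^ (-(1 / 2) : ℝ) = √2 / 2 := by
      rw [Real.rpow_neg (by norm_num), ← Real.sqrt_eq_rpow, ← one_div, Real.sqrt_div_self', one_div]
    have h3 : ((√2 : ℝ) : ℂ) * (√2 : ℝ) = 2 := by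
      rw [← Complex.ofReal_mul, Real.mul_self_sqrt (by norm_num)]; norm_num
    rw [Complex.exp_mul_I, ← Complex.ofReal_cos, ← Complex.ofReal_sin, Real.cos_pi_div_four,
      Real.sin_pi_div_four, h2]
    push_cast
    linear_combination (-(1 + Complex.I) / 4) * h3
  have hnorm : ‖(1 + Complex.I) / 2‖ ≤ 1 := by
    rw [norm_div]
    have := norm_add_le 1 Complex.I
    simp at this ⊢
    linarith
  rw [hw, polylog_conj, Complex.conj_im, polylog,
    Complex.im_tsum (summable_polylog (by norm_num) hnorm),
    imLi3]
  congr 2 with n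
  have h1 : ((1 + Complex.I) / 2) ^ (n + 1) =
      ((2 : ℝ) ^ (-(((n : ℝ) + 1) / 2)) : ℝ) *
        Complex.exp (((((n : ℝ) + 1) * π / 4 : ℝ) : ℂ) * Complex.I) := by
    rw [hexp, mul_pow, ← Complex.exp_nat_mul, ← Complex.ofReal_pow, ← Real.rpow_natCast,
      ← Real.rpow_mul (by norm_num)]
    congr 2
    · congr 1
      push_cast
      ring
    · push_cast
      ring
  rw [h1, show ((n : ℂ) + 1) ^ 3 = ((((n : ℝ) + 1) ^ 3 : ℝ) : ℂ) by push_cast; ring,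
    Complex.div_ofReal_im, Complex.im_ofReal_mul, Complex.exp_ofReal_mul_I_im,
    Real.rpow_neg (by norm_num)]
  field_simp

/-- A primitive of `log s / (s (1 - s))` on the slit unit disc. -/
noncomputable def logPrimitive (s : ℂ) : ℂ :=
  Complex.log s ^ 2 / 2 - Complex.log s * Complex.log (1 - s) - polylog 2 s

/-- A primitive of `log² s / (s (1 - s))` on the slit unit disc. -/
noncomputable def logSqPrimitive (s : ℂ) : ℂ :=
  Complex.log s ^ 3 / 3 + 2 * polylog 3 s - 2 * Complex.log s * polylog 2 s
    - Complex.log s ^ 2 * Complex.log (1 - s)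

lemma hasDerivAt_log_one_sub {s : ℂ} (hs : ‖s‖ < 1) :
    HasDerivAt (fun s => Complex.log (1 - s)) (-1 / (1 - s)) s := by
  have h : 1 - s ∈ Complex.slitPlane := by
    rw [sub_eq_add_neg]
    exact Complex.mem_slitPlane_of_norm_lt_one (by rwa [norm_neg])
  exact ((hasDerivAt_id s).const_sub 1).clog h

lemma hasDerivAt_polylog_two {s : ℂ} (hs : ‖s‖ < 1) (hs₀ : s ≠ 0) :
    HasDerivAt (polylog 2) (-Complex.log (1 - s) / s) s := by
  rw [← polylog_one hs]
  exact hasDerivAt_polylog_succ 1 hs₀ hs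

lemma one_sub_ne_zero_of_norm_lt_one {s : ℂ} (hs : ‖s‖ < 1) : 1 - s ≠ 0 := by
  intro h
  rw [← sub_eq_zero.1 h, norm_one] at hs
  exact lt_irrefl _ hs

lemma hasDerivAt_logPrimitive {s : ℂ} (hs : ‖s‖ < 1) (hs' : s ∈ Complex.slitPlane) :
    HasDerivAt logPrimitive (Complex.log s / (s * (1 - s))) s := by
  have hs₀ := Complex.slitPlane_ne_zero hs'
  have hs₁ := one_sub_ne_zero_of_norm_lt_one hs
  have hl := Complex.hasDerivAt_log hs'
  refine ((((hl.pow 2).div_const 2).sub (hl.mul (hasDerivAt_log_one_sub hs))).sub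
    (hasDerivAt_polylog_two hs hs₀)).congr_deriv ?_
  field_simp
  ring

lemma hasDerivAt_logSqPrimitive {s : ℂ} (hs : ‖s‖ < 1) (hs' : s ∈ Complex.slitPlane) :
    HasDerivAt logSqPrimitive (Complex.log s ^ 2 / (s * (1 - s))) s := by
  have hs₀ := Complex.slitPlane_ne_zero hs'
  have hs₁ := one_sub_ne_zero_of_norm_lt_one hs
  have hl := Complex.hasDerivAt_log hs'
  refine (((((hl.pow 3).div_const 3).add ((hasDerivAt_polylog_succ 2 hs₀ hs).const_mul 2)).sub
    ((hl.const_mul 2).mul (hasDerivAt_polylog_two hs hs₀))).sub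
    ((hl.pow 2).mul (hasDerivAt_log_one_sub hs))).congr_deriv ?_
  simp only [Pi.pow_apply]
  field_simp
  ring

lemma continuousAt_log_sq_mul_log_one_sub :
    ContinuousAt (fun s => Complex.log s ^ 2 * Complex.log (1 - s)) 1 := by
  have h0 : Complex.log 1 ^ 2 * Complex.log (1 - 1) = 0 := by simp
  rw [ContinuousAt, h0]
  have hlim : Filter.Tendsto (fun s : ℂ => 9 / 4 * (1 + π) * ‖1 - s‖) (nhds 1) (nhds 0) := by
    have : Continuous fun s : ℂ => 9 / 4 * (1 + π) * ‖1 - s‖ := by fun_prop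
    simpa using this.tendsto 1
  refine squeeze_zero_norm' ?_ hlim
  have hball : ∀ᶠ s : ℂ in nhds 1, ‖1 - s‖ < 1 / 2 := by
    have : Continuous fun s : ℂ => ‖1 - s‖ := by fun_prop
    exact this.continuousAt.eventually_lt continuousAt_const (by simp)
  filter_upwards [hball] with s hs
  rcases eq_or_ne s 1 with rfl | hs1
  · simp
  obtain ⟨z, rfl⟩ : ∃ z, s = 1 + z := ⟨s - 1, by ring⟩
  have hz : 1 - (1 + z) = -z := by ring
  rw [hz, norm_neg] at hs ⊢
  have hz0 : 0 < ‖z‖ := by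
    rw [norm_pos_iff]
    rintro rfl
    simp at hs1
  have h1 := Complex.norm_log_one_add_half_le_self hs.le
  have h2 : ‖Complex.log (-z)‖ * ‖z‖ ≤ 1 + π := by
    have h3 := Complex.norm_le_abs_re_add_abs_im (Complex.log (-z))
    rw [Complex.log_re, Complex.log_im, norm_neg] at h3
    have h4 := Complex.abs_arg_le_pi (-z)
    have h5 := (Real.abs_log_mul_self_lt ‖z‖ hz0 (by linarith)).le
    rw [abs_mul, abs_norm] at h5
    calc ‖Complex.log (-z)‖ * ‖z‖ ≤ (|Real.log ‖z‖| + |(-z).arg|) * ‖z‖ := by gcongr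
      _ = |Real.log ‖z‖| * ‖z‖ + |(-z).arg| * ‖z‖ := by ring
      _ ≤ 1 + π * 1 := by gcongr; linarith
      _ = 1 + π := by ring
  rw [norm_mul, norm_pow]
  calc ‖Complex.log (1 + z)‖ ^ 2 * ‖Complex.log (-z)‖
      ≤ (3 / 2 * ‖z‖) ^ 2 * ‖Complex.log (-z)‖ := by gcongr
    _ = 9 / 4 * (‖Complex.log (-z)‖ * ‖z‖) * ‖z‖ := by ring
    _ ≤ 9 / 4 * (1 + π) * ‖z‖ := by gcongr

lemma continuousWithinAt_logSqPrimitive_one :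
    ContinuousWithinAt logSqPrimitive (Metric.closedBall 0 1) 1 := by
  have h1 : (1 : ℂ) ∈ Metric.closedBall (0 : ℂ) 1 := by simp
  have hl : ContinuousWithinAt Complex.log (Metric.closedBall 0 1) 1 :=
    (continuousAt_clog Complex.one_mem_slitPlane).continuousWithinAt
  have h2 : ContinuousWithinAt (polylog 2) (Metric.closedBall 0 1) 1 :=
    continuousOn_polylog le_rfl 1 h1
  have h3 : ContinuousWithinAt (polylog 3) (Metric.closedBall 0 1) 1 :=
    continuousOn_polylog (by norm_num) 1 h1
  exact ((((hl.pow 3).div_const 3).add (continuousWithinAt_const.mul h3)).sub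
    ((continuousWithinAt_const.mul hl).mul h2)).sub
    continuousAt_log_sq_mul_log_one_sub.continuousWithinAt

lemma norm_inv_one_add_ofReal_mul_I_lt_one {y : ℝ} (hy : y ≠ 0) :
    ‖(1 + y * Complex.I)⁻¹‖ < 1 := by
  rw [norm_inv]
  apply inv_lt_one_of_one_lt₀
  rw [Complex.norm_def, Complex.normSq_apply]
  apply Real.lt_sqrt_of_sq_lt
  simp
  positivity

lemma norm_half_mul_one_sub_ofReal_mul_I_lt_one {y : ℝ} (hy : |y| ≤ 1) :
    ‖(1 - y * Complex.I) / 2‖ < 1 := by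
  have hy2 : y ^ 2 ≤ 1 := (sq_le_one_iff_abs_le_one y).2 hy
  rw [norm_div, Complex.norm_ofNat, div_lt_one two_pos, Complex.norm_def, Complex.normSq_apply,
    Real.sqrt_lt' two_pos]
  simp
  nlinarith

lemma one_add_ofReal_mul_I_ne_zero (y : ℝ) : (1 + y * Complex.I : ℂ) ≠ 0 :=
  fun h => by simpa using congrArg Complex.re h

lemma one_sub_ofReal_mul_I_ne_zero (y : ℝ) : (1 - y * Complex.I : ℂ) ≠ 0 :=
  fun h => by simpa using congrArg Complex.re h

lemma inv_one_add_ofReal_mul_I_mem_slitPlane (y : ℝ) :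
    (1 + y * Complex.I)⁻¹ ∈ Complex.slitPlane := by
  left
  rw [Complex.inv_re]
  refine div_pos (by simp) (Complex.normSq_pos.2 (one_add_ofReal_mul_I_ne_zero y))

lemma hasDerivAt_inv_one_add_ofReal_mul_I (y : ℝ) :
    HasDerivAt (fun y : ℝ => (1 + y * Complex.I)⁻¹)
      (-Complex.I / (1 + y * Complex.I) ^ 2) y :=
  (((hasDerivAt_id y).ofReal_comp.mul_const Complex.I).const_add 1).inv
    (one_add_ofReal_mul_I_ne_zero y) |>.congr_deriv (by simp)

lemma half_mul_one_sub_ofReal_mul_I_mem_slitPlane (y : ℝ) :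
    (1 - y * Complex.I) / 2 ∈ Complex.slitPlane := by
  left
  simp

lemma hasDerivAt_half_mul_one_sub_ofReal_mul_I (y : ℝ) :
    HasDerivAt (fun y : ℝ => (1 - y * Complex.I) / 2) (-Complex.I / 2) y :=
  (((hasDerivAt_id y).ofReal_comp.mul_const Complex.I).const_sub 1).div_const 2
    |>.congr_deriv (by simp)

/-- Landen's identity for the dilogarithm along the imaginary axis, at the endpoint. -/
lemma polylog_two_half_mul_one_add_I :
    polylog 2 ((1 + Complex.I) / 2) =
      (5 * π ^ 2 / 96 - Real.log 2 ^ 2 / 8 : ℝ)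
        + (catalanG - π * Real.log 2 / 8 : ℝ) * Complex.I := by
  let f : ℝ → ℂ := fun y => polylog 2 (1 - (1 + y * Complex.I)⁻¹) + polylog 2 (-(y * Complex.I))
    + Complex.log (1 + y * Complex.I) ^ 2 / 2
  have hsplit (y : ℝ) : 1 - (1 + y * Complex.I)⁻¹ = y * Complex.I / (1 + y * Complex.I) := by
    have := one_add_ofReal_mul_I_ne_zero y
    field_simp
    ring
  have hlt (y : ℝ) : ‖1 - (1 + y * Complex.I)⁻¹‖ < 1 := by
    rw [hsplit, norm_div, div_lt_one (norm_pos_iff.2 (one_add_ofReal_mul_I_ne_zero y))]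
    rw [norm_mul, Complex.norm_I, mul_one, Complex.norm_real, Real.norm_eq_abs, Complex.norm_def,
      Complex.normSq_apply]
    apply Real.lt_sqrt_of_sq_lt
    simp
    nlinarith
  have hslit (y : ℝ) : (1 + y * Complex.I : ℂ) ∈ Complex.slitPlane := Or.inl (by simp)
  have hder : ∀ y ∈ Set.Ioo (0 : ℝ) 1, HasDerivAt f 0 y := by
    intro y hy
    have hy0 : (y : ℂ) ≠ 0 := by exact_mod_cast hy.1.ne'
    have hyI : ‖-(y * Complex.I)‖ < 1 := by
      simpa [abs_of_pos hy.1] using hy.2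
    have hne := one_add_ofReal_mul_I_ne_zero y
    have hI := Complex.I_ne_zero
    have hlin : HasDerivAt (fun y : ℝ => (y : ℂ) * Complex.I) Complex.I y := by
      simpa using (hasDerivAt_id y).ofReal_comp.mul_const Complex.I
    have h1 := (hasDerivAt_polylog_two (hlt y)
      (by rw [hsplit]; exact div_ne_zero (mul_ne_zero hy0 hI) hne)).comp y
      ((hasDerivAt_inv_one_add_ofReal_mul_I y).const_sub 1)
    have h2 := (hasDerivAt_polylog_two hyI (by simp [hy0])).comp y hlin.neg
    have h3 := (((hlin.const_add 1).clog_real (hslit y)).pow 2).div_const 2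
    refine ((h1.add h2).add h3).congr_deriv ?_
    rw [sub_sub_cancel, log_inv_one_add_ofReal_mul_I, ← log_one_add_ofReal_mul_I, hsplit,
      sub_neg_eq_add]
    field_simp
    ring
  have hcont : ContinuousOn f (Set.Icc 0 1) := by
    have hinv : Continuous fun y : ℝ => 1 - (1 + y * Complex.I)⁻¹ :=
      continuous_const.sub (Continuous.inv₀ (by fun_prop) one_add_ofReal_mul_I_ne_zero)
    refine ContinuousOn.add (ContinuousOn.add ?_ ?_) ?_
    · refine (continuousOn_polylog le_rfl).comp hinv.continuousOn fun y _ => ?_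
      simpa using (hlt y).le
    · refine (continuousOn_polylog le_rfl).comp (by fun_prop) fun y hy => ?_
      simpa [abs_of_nonneg hy.1] using hy.2
    · exact (((Continuous.clog (by fun_prop) hslit).pow 2).div_const 2).continuousOn
  have h := intervalIntegral.integral_eq_sub_of_hasDerivAt_of_le zero_le_one hcont hder
    intervalIntegrable_const
  have h0 : f 0 = 0 := by simp [f, polylog_zero_right]
  have hw : 1 - (1 + ((1 : ℝ) : ℂ) * Complex.I)⁻¹ = (1 + Complex.I) / 2 := by
    have := one_add_ofReal_mul_I_ne_zero 1
    rw [hsplit]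
    push_cast at this ⊢
    rw [div_eq_div_iff this two_ne_zero]
    linear_combination (-1 : ℂ) * Complex.I_sq
  rw [intervalIntegral.integral_zero, h0, sub_zero] at h
  simp only [f] at h
  rw [hw, log_one_add_ofReal_mul_I, Real.arctan_one, Complex.ofReal_one, one_mul,
    polylog_two_neg_I, one_pow, one_add_one_eq_two] at h
  push_cast at h ⊢
  linear_combination -h - ((π : ℂ) ^ 2 / 32) * Complex.I_sq

lemma polylog_two_half_mul_one_sub_I :
    polylog 2 ((1 - Complex.I) / 2) =
      (5 * π ^ 2 / 96 - Real.log 2 ^ 2 / 8 : ℝ)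
        - (catalanG - π * Real.log 2 / 8 : ℝ) * Complex.I := by
  have hw : (1 - Complex.I) / 2 = (starRingEnd ℂ) ((1 + Complex.I) / 2) := by
    simp [sub_eq_add_neg, Complex.conj_ofNat]
  rw [hw, polylog_conj, polylog_two_half_mul_one_add_I, map_add, map_mul, Complex.conj_I,
    Complex.conj_ofReal, Complex.conj_ofReal]
  ring

lemma log_half_mul_one_sub_I :
    Complex.log ((1 - Complex.I) / 2) =
      (-(Real.log 2 / 2) : ℝ) - (π / 4 : ℝ) * Complex.I := by
  have h := log_half_mul_one_sub_ofReal_mul_I 1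
  rw [Real.arctan_one, Complex.ofReal_one, one_mul, one_pow, one_add_one_eq_two] at h
  rw [h]
  push_cast
  ring

lemma log_one_sub_half_mul_one_sub_I :
    Complex.log (1 - (1 - Complex.I) / 2) =
      (-(Real.log 2 / 2) : ℝ) + (π / 4 : ℝ) * Complex.I := by
  have h := log_half_mul_one_sub_ofReal_mul_I (-1)
  rw [Real.arctan_neg, Real.arctan_one, Complex.ofReal_neg, Complex.ofReal_one, neg_one_mul,
    neg_one_sq, one_add_one_eq_two] at h
  rw [show 1 - (1 - Complex.I) / 2 = (1 - -Complex.I) / 2 by ring, h]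
  push_cast
  ring

lemma im_logPrimitive_half_mul_one_sub_I :
    (logPrimitive ((1 - Complex.I) / 2)).im = catalanG := by
  rw [logPrimitive, log_half_mul_one_sub_I, log_one_sub_half_mul_one_sub_I,
    polylog_two_half_mul_one_sub_I]
  simp [pow_two, -Complex.ofReal_div, -Complex.ofReal_neg, -Complex.ofReal_mul,
    -Complex.ofReal_sub, -Complex.ofReal_pow]
  ring

lemma im_logSqPrimitive_half_mul_one_sub_I :
    (logSqPrimitive ((1 - Complex.I) / 2)).im =
      -2 * imLi3 - catalanG * Real.log 2 + π * Real.log 2 ^ 2 / 16 + 3 * π ^ 3 / 64 := by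
  rw [logSqPrimitive, log_half_mul_one_sub_I, log_one_sub_half_mul_one_sub_I,
    polylog_two_half_mul_one_sub_I, ← Complex.re_add_im (polylog 3 ((1 - Complex.I) / 2)),
    im_polylog_three_half_one_sub_I]
  generalize (polylog 3 ((1 - Complex.I) / 2)).re = r
  generalize Real.log 2 = l
  have h3 : ∀ z : ℂ, (z / 3).im = z.im / 3 := fun z => by simp
  simp [pow_succ, h3]
  ring

lemma HasDerivAt.complex_im {f : ℝ → ℂ} {f' : ℂ} {y : ℝ} (h : HasDerivAt f f' y) :
    HasDerivAt (fun y => (f y).im) f'.im y :=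
  Complex.imCLM.hasFDerivAt.comp_hasDerivAt y h

lemma HasDerivAt.complex_re {f : ℝ → ℂ} {f' : ℂ} {y : ℝ} (h : HasDerivAt f f' y) :
    HasDerivAt (fun y => (f y).re) f'.re y :=
  Complex.reCLM.hasFDerivAt.comp_hasDerivAt y h

lemma hasDerivAt_im_logPrimitive_half {y : ℝ} (hy : |y| ≤ 1) :
    HasDerivAt (fun y : ℝ => (logPrimitive ((1 - y * Complex.I) / 2)).im)
      ((2 * Real.log 2 - Real.log (1 + y ^ 2)) / (1 + y ^ 2)) y := by
  refine (((hasDerivAt_logPrimitive (norm_half_mul_one_sub_ofReal_mul_I_lt_one hy)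
    (half_mul_one_sub_ofReal_mul_I_mem_slitPlane y)).comp y
    (hasDerivAt_half_mul_one_sub_ofReal_mul_I y)).complex_im).congr_deriv ?_
  have hc : (1 - y * Complex.I) / 2 * (1 - (1 - y * Complex.I) / 2) = ((1 + y ^ 2) / 4 : ℝ) := by
    push_cast
    linear_combination -(y : ℂ) ^ 2 / 4 * Complex.I_sq
  have hy' : (1 + y ^ 2 : ℝ) ≠ 0 := by positivity
  rw [hc, log_half_mul_one_sub_ofReal_mul_I, mul_div_assoc', Complex.div_ofNat_im,
    div_mul_eq_mul_div, Complex.div_ofReal_im]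
  simp [-Complex.ofReal_div, -Complex.ofReal_neg, -Complex.ofReal_mul,
    -Complex.ofReal_sub, -Complex.ofReal_pow, -Complex.ofReal_arctan]
  field_simp
  ring

lemma hasDerivAt_im_logSqPrimitive_half {y : ℝ} (hy : |y| ≤ 1) :
    HasDerivAt (fun y : ℝ => (logSqPrimitive ((1 - y * Complex.I) / 2)).im)
      (-2 * ((Real.log (1 + y ^ 2) / 2 - Real.log 2) ^ 2 - Real.arctan y ^ 2) / (1 + y ^ 2)) y := by
  refine (((hasDerivAt_logSqPrimitive (norm_half_mul_one_sub_ofReal_mul_I_lt_one hy)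
    (half_mul_one_sub_ofReal_mul_I_mem_slitPlane y)).comp y
    (hasDerivAt_half_mul_one_sub_ofReal_mul_I y)).complex_im).congr_deriv ?_
  have hc : (1 - y * Complex.I) / 2 * (1 - (1 - y * Complex.I) / 2) = ((1 + y ^ 2) / 4 : ℝ) := by
    push_cast
    linear_combination -(y : ℂ) ^ 2 / 4 * Complex.I_sq
  have hy' : (1 + y ^ 2 : ℝ) ≠ 0 := by positivity
  rw [hc, log_half_mul_one_sub_ofReal_mul_I, mul_div_assoc', Complex.div_ofNat_im,
    div_mul_eq_mul_div, Complex.div_ofReal_im]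
  simp [pow_two, -Complex.ofReal_div, -Complex.ofReal_neg, -Complex.ofReal_mul,
    -Complex.ofReal_sub, -Complex.ofReal_pow, -Complex.ofReal_arctan]
  field_simp
  ring

lemma hasDerivAt_im_logSqPrimitive_inv {y : ℝ} (hy : 0 < y) :
    HasDerivAt (fun y : ℝ => (logSqPrimitive (1 + y * Complex.I)⁻¹).im)
      (-(Real.arctan y * Real.log (1 + y ^ 2) / y)) y := by
  refine (((hasDerivAt_logSqPrimitive (norm_inv_one_add_ofReal_mul_I_lt_one hy.ne')
    (inv_one_add_ofReal_mul_I_mem_slitPlane y)).comp y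
    (hasDerivAt_inv_one_add_ofReal_mul_I y)).complex_im).congr_deriv ?_
  have hne := one_add_ofReal_mul_I_ne_zero y
  have hy0 : (y : ℂ) ≠ 0 := by exact_mod_cast hy.ne'
  have hc (z : ℂ) : z / ((1 + y * Complex.I)⁻¹ * (1 - (1 + y * Complex.I)⁻¹)) *
      (-Complex.I / (1 + y * Complex.I) ^ 2) = -z / (y : ℝ) := by
    have hI := Complex.I_ne_zero
    rw [show 1 - (1 + y * Complex.I)⁻¹ = y * Complex.I * (1 + y * Complex.I)⁻¹ by
      field_simp; ring]
    field_simp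
  rw [hc, log_inv_one_add_ofReal_mul_I, Complex.div_ofReal_im]
  simp [pow_two, -Complex.ofReal_div, -Complex.ofReal_neg, -Complex.ofReal_mul,
    -Complex.ofReal_sub, -Complex.ofReal_pow, -Complex.ofReal_arctan]
  field_simp
  ring

lemma hasDerivAt_re_polylog_two_imaginary {y : ℝ} (hy : y ∈ Set.Ioo (0 : ℝ) 1) :
    HasDerivAt (fun y : ℝ => (polylog 2 (-(y * Complex.I))).re)
      (-(Real.log (1 + y ^ 2) / (2 * y))) y := by
  have hy0 : (y : ℂ) ≠ 0 := by exact_mod_cast hy.1.ne'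
  have hyI : ‖-(y * Complex.I)‖ < 1 := by
    simpa [abs_of_pos hy.1] using hy.2
  have hlin : HasDerivAt (fun y : ℝ => -((y : ℂ) * Complex.I)) (-Complex.I) y := by
    exact ((hasDerivAt_id y).ofReal_comp.mul_const Complex.I).neg.congr_deriv (by simp)
  refine (((hasDerivAt_polylog_two hyI (by simp [hy0])).comp y hlin).complex_re).congr_deriv ?_
  have hI := Complex.I_ne_zero
  rw [sub_neg_eq_add, show -Complex.log (1 + y * Complex.I) / -(y * Complex.I) * -Complex.I =
    -Complex.log (1 + y * Complex.I) / (y : ℝ) by field_simp, Complex.div_ofReal_re,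
    log_one_add_ofReal_mul_I]
  simp [-Complex.ofReal_div, -Complex.ofReal_arctan]
  ring

lemma im_logPrimitive_ofReal {x : ℝ} (h₀ : 0 ≤ x) (h₁ : x ≤ 1) : (logPrimitive x).im = 0 := by
  have h2 : polylog 2 x = ((polylog 2 x).re : ℂ) :=
    Complex.ext rfl (by rw [polylog_ofReal_im, Complex.ofReal_im])
  have h : (1 : ℂ) - x = ((1 - x : ℝ) : ℂ) := by push_cast; ring
  rw [logPrimitive, h2, h, ← Complex.ofReal_log h₀, ← Complex.ofReal_log (sub_nonneg.2 h₁)]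
  norm_cast

lemma im_logSqPrimitive_ofReal {x : ℝ} (h₀ : 0 ≤ x) (h₁ : x ≤ 1) :
    (logSqPrimitive x).im = 0 := by
  have h2 : polylog 2 x = ((polylog 2 x).re : ℂ) :=
    Complex.ext rfl (by rw [polylog_ofReal_im, Complex.ofReal_im])
  have h3 : polylog 3 x = ((polylog 3 x).re : ℂ) :=
    Complex.ext rfl (by rw [polylog_ofReal_im, Complex.ofReal_im])
  have h : (1 : ℂ) - x = ((1 - x : ℝ) : ℂ) := by push_cast; ring
  rw [logSqPrimitive, h2, h3, h, ← Complex.ofReal_log h₀, ← Complex.ofReal_log (sub_nonneg.2 h₁)]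
  norm_cast

theorem integral_log_one_add_sq_div_one_add_sq :
    ∫ y in (0 : ℝ)..1, Real.log (1 + y ^ 2) / (1 + y ^ 2) = π / 2 * Real.log 2 - catalanG := by
  have hder : ∀ y ∈ Set.uIcc (0 : ℝ) 1, HasDerivAt
      (fun y : ℝ => 2 * Real.log 2 * Real.arctan y - (logPrimitive ((1 - y * Complex.I) / 2)).im)
      (Real.log (1 + y ^ 2) / (1 + y ^ 2)) y := by
    intro y hy
    rw [Set.uIcc_of_le zero_le_one] at hy
    refine (((Real.hasDerivAt_arctan y).const_mul (2 * Real.log 2)).sub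
      (hasDerivAt_im_logPrimitive_half (abs_le.2 ⟨by linarith [hy.1], hy.2⟩))).congr_deriv ?_
    ring
  have hint : Continuous fun y : ℝ => Real.log (1 + y ^ 2) / (1 + y ^ 2) := by
    refine Continuous.div (Continuous.log (by fun_prop) fun y => by positivity) (by fun_prop)
      fun y => by positivity
  rw [intervalIntegral.integral_eq_sub_of_hasDerivAt hder (hint.intervalIntegrable _ _)]
  have h0 := im_logPrimitive_ofReal (x := 1 / 2) (by norm_num) (by norm_num)
  rw [Complex.ofReal_div, Complex.ofReal_one, Complex.ofReal_ofNat] at h0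
  rw [Complex.ofReal_one, Complex.ofReal_zero, one_mul, zero_mul, sub_zero,
    im_logPrimitive_half_mul_one_sub_I, h0, Real.arctan_zero, Real.arctan_one]
  ring

lemma continuousOn_logSqPrimitive_inv :
    ContinuousOn (fun y : ℝ => logSqPrimitive (1 + y * Complex.I)⁻¹) (Set.Icc 0 1) := by
  have hinv : Continuous fun y : ℝ => (1 + y * Complex.I)⁻¹ :=
    Continuous.inv₀ (by fun_prop) one_add_ofReal_mul_I_ne_zero
  intro y _
  rcases eq_or_ne y 0 with rfl | hy
  · have h1 : (1 + ((0 : ℝ) : ℂ) * Complex.I)⁻¹ = 1 := by simp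
    have h := continuousWithinAt_logSqPrimitive_one
    rw [← h1] at h
    refine ContinuousWithinAt.comp (g := logSqPrimitive)
      (f := fun y : ℝ => (1 + y * Complex.I)⁻¹) (t := Metric.closedBall 0 1) h
      hinv.continuousWithinAt fun z _ => ?_
    rw [mem_closedBall_zero_iff]
    rcases eq_or_ne z 0 with rfl | hz
    · simp
    · exact (norm_inv_one_add_ofReal_mul_I_lt_one hz).le
  · exact (ContinuousAt.comp (g := logSqPrimitive) (f := fun y : ℝ => (1 + y * Complex.I)⁻¹)
      (hasDerivAt_logSqPrimitive (norm_inv_one_add_ofReal_mul_I_lt_one hy)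
        (inv_one_add_ofReal_mul_I_mem_slitPlane y)).continuousAt
      hinv.continuousAt).continuousWithinAt

/-- An explicit primitive of the kernel of `integral_arctan_log_kernel`. -/
noncomputable def arctanLogPrimitive (y : ℝ) : ℝ :=
  -(π / 2) * (polylog 2 (-(y * Complex.I))).re + (logSqPrimitive (1 + y * Complex.I)⁻¹).im
    - (π / 4 - Real.arctan y) * Real.log (1 + y ^ 2) ^ 2 / 2
    + (logSqPrimitive ((1 - y * Complex.I) / 2)).im
    + 2 * Real.log 2 * (logPrimitive ((1 - y * Complex.I) / 2)).im
    - 2 * Real.log 2 ^ 2 * Real.arctan y - 2 / 3 * Real.arctan y ^ 3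

lemma hasDerivAt_arctanLogPrimitive {y : ℝ} (hy : y ∈ Set.Ioo (0 : ℝ) 1) :
    HasDerivAt arctanLogPrimitive ((π / 4 - Real.arctan y) * ((1 - y ^ 2) / (y * (1 + y ^ 2)))
        * Real.log (1 + y ^ 2)) y := by
  have habs : |y| ≤ 1 := abs_le.2 ⟨by linarith [hy.1], hy.2.le⟩
  have hy' : (1 + y ^ 2 : ℝ) ≠ 0 := by positivity
  have hy0 : y ≠ 0 := hy.1.ne'
  have ha := Real.hasDerivAt_arctan y
  have hl : HasDerivAt (fun y : ℝ => Real.log (1 + y ^ 2)) (2 * y / (1 + y ^ 2)) y :=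
    (((hasDerivAt_pow 2 y).const_add 1).log hy').congr_deriv (by simp)
  refine ((((((((hasDerivAt_re_polylog_two_imaginary hy).const_mul (-(π / 2))).add
    (hasDerivAt_im_logSqPrimitive_inv hy.1)).sub
    (((ha.const_sub (π / 4)).mul (hl.pow 2)).div_const 2)).add
    (hasDerivAt_im_logSqPrimitive_half habs)).add
    ((hasDerivAt_im_logPrimitive_half habs).const_mul (2 * Real.log 2))).sub
    (ha.const_mul (2 * Real.log 2 ^ 2))).sub
    ((ha.pow 3).const_mul (2 / 3))).congr_deriv ?_
  simp only [Pi.pow_apply]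
  field_simp
  ring

lemma continuousOn_arctanLogPrimitive : ContinuousOn arctanLogPrimitive (Set.Icc 0 1) := by
  have hlog : Continuous fun y : ℝ => Real.log (1 + y ^ 2) :=
    Continuous.log (by fun_prop) fun y => by positivity
  have habs : ∀ y ∈ Set.Icc (0 : ℝ) 1, |y| ≤ 1 := fun y hy => abs_le.2 ⟨by linarith [hy.1], hy.2⟩
  have h1 : ContinuousOn (fun y : ℝ => (polylog 2 (-(y * Complex.I))).re) (Set.Icc 0 1) := by
    refine Complex.continuous_re.comp_continuousOn
      ((continuousOn_polylog le_rfl).comp (by fun_prop) fun y hy => ?_)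
    simpa using habs y hy
  have h2 := Complex.continuous_im.comp_continuousOn continuousOn_logSqPrimitive_inv
  have h3 : ContinuousOn (fun y : ℝ => (logSqPrimitive ((1 - y * Complex.I) / 2)).im)
      (Set.Icc 0 1) :=
    fun y hy => (hasDerivAt_im_logSqPrimitive_half (habs y hy)).continuousAt.continuousWithinAt
  have h4 : ContinuousOn (fun y : ℝ => (logPrimitive ((1 - y * Complex.I) / 2)).im)
      (Set.Icc 0 1) :=
    fun y hy => (hasDerivAt_im_logPrimitive_half (habs y hy)).continuousAt.continuousWithinAt
  have ha := Real.continuous_arctan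
  exact ((((((continuousOn_const.mul h1).add h2).sub
    (((continuous_const.sub ha).mul (hlog.pow 2)).div_const 2).continuousOn).add h3).add
    (continuousOn_const.mul h4)).sub (continuous_const.mul ha).continuousOn).sub
    (continuous_const.mul (ha.pow 3)).continuousOn

lemma arctanLogPrimitive_zero : arctanLogPrimitive 0 = 0 := by
  have h0 := im_logPrimitive_ofReal (x := 1 / 2) (by norm_num) (by norm_num)
  have h1 := im_logSqPrimitive_ofReal (x := 1 / 2) (by norm_num) (by norm_num)
  have h2 := im_logSqPrimitive_ofReal (x := 1) (by norm_num) le_rfl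
  rw [Complex.ofReal_div, Complex.ofReal_one, Complex.ofReal_ofNat] at h0 h1
  rw [Complex.ofReal_one] at h2
  rw [arctanLogPrimitive, Complex.ofReal_zero, zero_mul, sub_zero, h0, h1,
    show (1 + 0 : ℂ)⁻¹ = 1 by simp, h2, neg_zero, polylog_zero_right]
  simp

lemma arctanLogPrimitive_one : arctanLogPrimitive 1 =
    -4 * imLi3 - 3 * π * Real.log 2 ^ 2 / 8 + 3 * π ^ 3 / 32 := by
  have hw : (1 + Complex.I)⁻¹ = (1 - Complex.I) / 2 := by
    have h := one_add_ofReal_mul_I_ne_zero 1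
    rw [Complex.ofReal_one, one_mul] at h
    rw [inv_eq_iff_eq_inv, inv_div, eq_div_iff]
    · linear_combination -Complex.I_sq
    · simpa using one_sub_ofReal_mul_I_ne_zero 1
  rw [arctanLogPrimitive, Complex.ofReal_one, one_mul, hw, im_logPrimitive_half_mul_one_sub_I,
    im_logSqPrimitive_half_mul_one_sub_I, polylog_two_neg_I, Real.arctan_one]
  simp [-Complex.ofReal_div, -Complex.ofReal_neg, -Complex.ofReal_pow]
  ring

lemma arctan_kernel_nonneg {y : ℝ} (hy : y ∈ Set.Ioo (0 : ℝ) 1) :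
    0 ≤ (π / 4 - Real.arctan y) * ((1 - y ^ 2) / (y * (1 + y ^ 2))) := by
  have h1 : 0 ≤ π / 4 - Real.arctan y := by
    rw [← Real.arctan_one, sub_nonneg]
    exact Real.arctan_mono hy.2.le
  have h2 : 0 ≤ 1 - y ^ 2 := by nlinarith [hy.1, hy.2]
  have := hy.1
  positivity

theorem integral_arctan_log_kernel :
    ∫ y in (0 : ℝ)..1, (π / 4 - Real.arctan y) * ((1 - y ^ 2) / (y * (1 + y ^ 2)))
        * Real.log (1 + y ^ 2) =
      -4 * imLi3 - 3 * π * Real.log 2 ^ 2 / 8 + 3 * π ^ 3 / 32 := by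
  rw [intervalIntegral.integral_eq_sub_of_hasDerivAt_of_le zero_le_one
    continuousOn_arctanLogPrimitive (fun y hy => hasDerivAt_arctanLogPrimitive hy),
    arctanLogPrimitive_zero, arctanLogPrimitive_one, sub_zero]
  rw [intervalIntegrable_iff_integrableOn_Ioc_of_le zero_le_one]
  exact intervalIntegral.integrableOn_deriv_of_nonneg continuousOn_arctanLogPrimitive
    (fun y hy => hasDerivAt_arctanLogPrimitive hy) fun y hy =>
      mul_nonneg (arctan_kernel_nonneg hy) (Real.log_nonneg (by nlinarith))

/-- The normalized central binomial coefficient `C(2n,n) / 4ⁿ`. -/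
noncomputable def normCentralBinom (n : ℕ) : ℝ := n.centralBinom / 4 ^ n

lemma normCentralBinom_zero : normCentralBinom 0 = 1 := by simp [normCentralBinom]

lemma normCentralBinom_succ (n : ℕ) :
    normCentralBinom (n + 1) = normCentralBinom n * ((2 * n + 1) / (2 * n + 2)) := by
  have h : ((n : ℝ) + 1) * (n + 1).centralBinom = 2 * (2 * n + 1) * n.centralBinom := by
    exact_mod_cast n.succ_mul_centralBinom_succ
  have hn : (n : ℝ) + 1 ≠ 0 := n.cast_add_one_ne_zero
  rw [normCentralBinom, normCentralBinom, pow_succ]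
  field_simp
  linear_combination 2 * h

lemma normCentralBinom_pos (n : ℕ) : 0 < normCentralBinom n := by
  have := n.centralBinom_pos
  rw [normCentralBinom]
  positivity

lemma normCentralBinom_eq_prod (n : ℕ) :
    normCentralBinom n = ∏ i ∈ Finset.range n, (2 * (i : ℝ) + 1) / (2 * i + 2) := by
  induction n with
  | zero => simp [normCentralBinom_zero]
  | succ n ih => rw [normCentralBinom_succ, Finset.prod_range_succ, ih]

lemma two_mul_add_one_mul_normCentralBinom_sq_le_one (n : ℕ) :
    (2 * n + 1) * normCentralBinom n ^ 2 ≤ 1 := by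
  induction n with
  | zero => simp [normCentralBinom_zero]
  | succ n ih =>
    refine le_trans ?_ ih
    rw [normCentralBinom_succ, mul_pow, div_pow, mul_left_comm, mul_comm (2 * (n : ℝ) + 1)]
    gcongr
    rw [mul_div_assoc', div_le_iff₀ (by positivity)]
    push_cast
    nlinarith [n.cast_nonneg (α := ℝ)]

lemma normCentralBinom_succ_sq_le (n : ℕ) : normCentralBinom (n + 1) ^ 2 ≤ 1 / ((n : ℝ) + 1) := by
  rw [le_div_iff₀ (by positivity)]
  have h := two_mul_add_one_mul_normCentralBinom_sq_le_one (n + 1)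
  push_cast at h
  nlinarith [n.cast_nonneg (α := ℝ), sq_nonneg (normCentralBinom (n + 1))]

lemma normCentralBinom_le_one (n : ℕ) : normCentralBinom n ≤ 1 := by
  have h := two_mul_add_one_mul_normCentralBinom_sq_le_one n
  nlinarith [n.cast_nonneg (α := ℝ), normCentralBinom_pos n]

lemma choose_neg_half (n : ℕ) :
    Ring.choose (-(1 / 2) : ℝ) n = (-1) ^ n * normCentralBinom n := by
  induction n with
  | zero => simp [normCentralBinom_zero]
  | succ n ih =>
    have h := Ring.choose_smul_choose (-(1 / 2) : ℝ) (n.le_succ)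
    rw [Nat.succ_eq_add_one, Nat.choose_succ_self_right, Nat.add_sub_cancel_left,
      Ring.choose_one_right, ih, nsmul_eq_mul] at h
    have hn : ((n + 1 : ℕ) : ℝ) ≠ 0 := Nat.cast_ne_zero.2 n.succ_ne_zero
    apply mul_left_cancel₀ hn
    rw [h, normCentralBinom_succ]
    push_cast
    field_simp
    ring

lemma hasSum_normCentralBinom {x : ℝ} (hx₀ : 0 ≤ x) (hx : x < 1) :
    HasSum (fun n => normCentralBinom n * x ^ n) ((1 - x) ^ (-(1 / 2) : ℝ)) := by
  have h := (Real.one_add_rpow_hasFPowerSeriesOnBall_zero (a := -(1 / 2))).hasSum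
    (y := -x) (by simp [abs_of_nonneg hx₀, enorm_eq_nnnorm, ← NNReal.coe_lt_coe, hx])
  rw [zero_add, ← sub_eq_add_neg] at h
  refine h.congr_fun fun n => ?_
  have hc := choose_neg_half n
  rw [one_div] at hc
  simp only [binomialSeries, FormalMultilinearSeries.ofScalars_apply_eq, one_div, hc, smul_eq_mul]
  rw [neg_pow x n, mul_mul_mul_comm, ← mul_pow, neg_one_mul, neg_neg, one_pow, one_mul]

lemma hasSum_normCentralBinom_succ {x : ℝ} (hx₀ : 0 < x) (hx : x < 1) :
    HasSum (fun n => normCentralBinom (n + 1) * x ^ n) (((1 - x) ^ (-(1 / 2) : ℝ) - 1) / x) := by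
  have h := (hasSum_nat_add_iff' 1).2 (hasSum_normCentralBinom hx₀.le hx)
  simp only [Finset.sum_range_one, normCentralBinom_zero, pow_zero, mul_one] at h
  refine (h.div_const x).congr_fun fun n => ?_
  field_simp
  ring

/-- The power series `∑_{n ≥ 1} C(2n,n) / 4ⁿ * xⁿ / n`. -/
noncomputable def centralBinomLog (x : ℝ) : ℝ :=
  ∑' n : ℕ, normCentralBinom (n + 1) / ((n : ℝ) + 1) * x ^ (n + 1)

lemma summable_centralBinomLog {x : ℝ} (hx : |x| < 1) :
    Summable fun n : ℕ => normCentralBinom (n + 1) / ((n : ℝ) + 1) * x ^ (n + 1) := by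
  refine .of_norm_bounded (summable_geometric_of_lt_one (abs_nonneg x) hx) fun n => ?_
  rw [norm_mul, norm_pow, Real.norm_eq_abs x, Real.norm_of_nonneg
    (div_nonneg (normCentralBinom_pos _).le n.cast_add_one_pos.le), pow_succ,
    ← mul_assoc, mul_right_comm]
  refine mul_le_of_le_one_left (by positivity) (mul_le_one₀ ?_ (abs_nonneg x) hx.le)
  rw [div_le_one n.cast_add_one_pos]
  linarith [normCentralBinom_le_one (n + 1), n.cast_nonneg (α := ℝ)]

lemma hasDerivAt_centralBinomLog {x : ℝ} (hx : |x| < 1) :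
    HasDerivAt centralBinomLog (∑' n : ℕ, normCentralBinom (n + 1) * x ^ n) x := by
  obtain ⟨r, hxr, hr⟩ := exists_between hx
  have hr₀ : 0 ≤ r := (abs_nonneg x).trans hxr.le
  refine hasDerivAt_tsum_of_isPreconnected (t := Metric.ball 0 r) (y₀ := 0)
    (u := fun n => r ^ n)
    (g := fun (n : ℕ) (y : ℝ) => normCentralBinom (n + 1) / ((n : ℝ) + 1) * y ^ (n + 1))
    (g' := fun n y => normCentralBinom (n + 1) * y ^ n)
    (summable_geometric_of_lt_one hr₀ hr) Metric.isOpen_ball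
    (convex_ball _ _).isPreconnected ?_ ?_ (Metric.mem_ball_self ((abs_nonneg x).trans_lt hxr))
    (by simp [summable_zero]) (by simpa using hxr)
  · intro n y _
    have hn : (n : ℝ) + 1 ≠ 0 := n.cast_add_one_ne_zero
    refine ((hasDerivAt_pow (n + 1) y).const_mul _).congr_deriv ?_
    rw [Nat.add_sub_cancel, Nat.cast_succ]
    field_simp
  · intro n y hy
    have hy' : |y| ≤ r := by simpa using (Metric.mem_ball.1 hy).le
    rw [norm_mul, norm_pow, Real.norm_eq_abs y, Real.norm_of_nonneg (normCentralBinom_pos _).le]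
    exact (mul_le_of_le_one_left (by positivity) (normCentralBinom_le_one _)).trans (by gcongr)

/-- The sine of `2 * arctan y` as a rational function of `y`. -/
noncomputable def sinTwoArctan (y : ℝ) : ℝ := 2 * y / (1 + y ^ 2)

lemma hasDerivAt_sinTwoArctan (y : ℝ) :
    HasDerivAt sinTwoArctan (2 * (1 - y ^ 2) / (1 + y ^ 2) ^ 2) y := by
  have hy : (1 + y ^ 2 : ℝ) ≠ 0 := by positivity
  refine (((hasDerivAt_id y).const_mul 2).div ((hasDerivAt_pow 2 y).const_add 1) hy).congr_deriv ?_
  simp only [id]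
  field_simp
  ring

lemma continuous_sinTwoArctan : Continuous sinTwoArctan :=
  Continuous.div (by fun_prop) (by fun_prop) fun y => by positivity

lemma sinTwoArctan_zero : sinTwoArctan 0 = 0 := by simp [sinTwoArctan]

lemma sinTwoArctan_nonneg {y : ℝ} (hy : 0 ≤ y) : 0 ≤ sinTwoArctan y := by
  rw [sinTwoArctan]
  positivity

lemma sinTwoArctan_lt_one {y : ℝ} (hy : y < 1) : sinTwoArctan y < 1 := by
  rw [sinTwoArctan, div_lt_one (by positivity)]
  nlinarith [sq_pos_of_pos (sub_pos.2 hy)]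

lemma sin_two_mul_arctan (y : ℝ) : Real.sin (2 * Real.arctan y) = sinTwoArctan y := by
  have h : √(1 + y ^ 2) ^ 2 = 1 + y ^ 2 := Real.sq_sqrt (by positivity)
  have h0 : √(1 + y ^ 2) ≠ 0 := by positivity
  rw [Real.sin_two_mul, Real.sin_arctan, Real.cos_arctan, sinTwoArctan]
  field_simp
  rw [h]

lemma one_sub_sinTwoArctan_sq_rpow {y : ℝ} (hy : y ∈ Set.Ico (0 : ℝ) 1) :
    (1 - sinTwoArctan y ^ 2) ^ (-(1 / 2) : ℝ) = (1 + y ^ 2) / (1 - y ^ 2) := by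
  have h1 : 0 < 1 - y ^ 2 := by nlinarith [hy.1, hy.2]
  have h : 1 - sinTwoArctan y ^ 2 = ((1 - y ^ 2) / (1 + y ^ 2)) ^ 2 := by
    rw [sinTwoArctan]
    field_simp
    ring
  rw [h, Real.rpow_neg (by positivity), ← Real.sqrt_eq_rpow, Real.sqrt_sq (by positivity), inv_div]

lemma hasDerivAt_centralBinomLog_sinTwoArctan_sq {y : ℝ} (hy : y ∈ Set.Ico (0 : ℝ) 1) :
    HasDerivAt (fun y => centralBinomLog (sinTwoArctan y ^ 2)) (4 * y / (1 + y ^ 2)) y := by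
  have hlt : sinTwoArctan y ^ 2 < 1 :=
    pow_lt_one₀ (sinTwoArctan_nonneg hy.1) (sinTwoArctan_lt_one hy.2) two_ne_zero
  have h := (hasDerivAt_centralBinomLog (x := sinTwoArctan y ^ 2)
    (by rwa [abs_of_nonneg (sq_nonneg _)])).comp y ((hasDerivAt_sinTwoArctan y).pow 2)
  refine h.congr_deriv ?_
  rcases hy.1.eq_or_lt with rfl | hy0
  · simp [sinTwoArctan_zero]
  · have hσ : 0 < sinTwoArctan y := by rw [sinTwoArctan]; positivity
    have h1 : 1 - y ^ 2 ≠ 0 := by nlinarith [hy.2]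
    have h2 : 1 + y ^ 2 ≠ 0 := by positivity
    rw [(hasSum_normCentralBinom_succ (by positivity) hlt).tsum_eq,
      one_sub_sinTwoArctan_sq_rpow hy, sinTwoArctan, Nat.add_one_sub_one, pow_one, Nat.cast_ofNat]
    field_simp
    ring

lemma centralBinomLog_sinTwoArctan_sq {y : ℝ} (hy : y ∈ Set.Ico (0 : ℝ) 1) :
    centralBinomLog (sinTwoArctan y ^ 2) = 2 * Real.log (1 + y ^ 2) := by
  have hd : ∀ t ∈ Set.Icc 0 y, HasDerivAt
      (fun y => centralBinomLog (sinTwoArctan y ^ 2) - 2 * Real.log (1 + y ^ 2)) 0 t := by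
    intro t ht
    have ht' : (1 + t ^ 2 : ℝ) ≠ 0 := by positivity
    refine ((hasDerivAt_centralBinomLog_sinTwoArctan_sq ⟨ht.1, ht.2.trans_lt hy.2⟩).sub
      ((((hasDerivAt_pow 2 t).const_add 1).log ht').const_mul 2)).congr_deriv ?_
    field_simp
    ring
  have h := constant_of_has_deriv_right_zero
    (fun t ht => (hd t ht).continuousAt.continuousWithinAt)
    (fun t ht => (hd t ⟨ht.1, ht.2.le⟩).hasDerivWithinAt) y ⟨hy.1, le_rfl⟩
  simpa [sinTwoArctan_zero, centralBinomLog, sub_eq_zero] using h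

lemma hasSum_normCentralBinom_mul_sinTwoArctan {y : ℝ} (hy : y ∈ Set.Ico (0 : ℝ) 1) :
    HasSum (fun n : ℕ => normCentralBinom (n + 1) / ((n : ℝ) + 1) * sinTwoArctan y ^ (2 * (n + 1)))
      (2 * Real.log (1 + y ^ 2)) := by
  have hlt : sinTwoArctan y ^ 2 < 1 :=
    pow_lt_one₀ (sinTwoArctan_nonneg hy.1) (sinTwoArctan_lt_one hy.2) two_ne_zero
  rw [← centralBinomLog_sinTwoArctan_sq hy]
  simp only [pow_mul]
  exact (summable_centralBinomLog (by rwa [abs_of_nonneg (sq_nonneg _)])).hasSum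

lemma integral_sinTwoArctan_pow (n : ℕ) :
    ∫ y in (0 : ℝ)..1, sinTwoArctan y ^ (2 * n) / (1 + y ^ 2) = π / 4 * normCentralBinom n := by
  have hsub := intervalIntegral.integral_comp_mul_deriv (a := 0) (b := 1)
    (f := Real.arctan) (f' := fun y => 1 / (1 + y ^ 2))
    (g := fun u => Real.cos (π / 2 - 2 * u) ^ (2 * n))
    (fun y _ => Real.hasDerivAt_arctan y)
    (Continuous.continuousOn (by
      exact Continuous.div (by fun_prop) (by fun_prop) fun y => by positivity))
    (by fun_prop)
  rw [Real.arctan_zero, Real.arctan_one,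
    intervalIntegral.integral_comp_sub_mul (fun u => Real.cos u ^ (2 * n)) two_ne_zero,
    show π / 2 - 2 * (π / 4) = 0 by ring, mul_zero, sub_zero, EulerSine.integral_cos_pow_eq,
    integral_sin_pow_even, ← normCentralBinom_eq_prod] at hsub
  simp only [Function.comp_apply, Real.cos_pi_div_two_sub, sin_two_mul_arctan, mul_one_div] at hsub
  rw [hsub, smul_eq_mul]
  ring

lemma arctan_kernel_mul_sinTwoArctan_pow (n : ℕ) (y : ℝ) :
    (π / 4 - Real.arctan y) * ((1 - y ^ 2) / (y * (1 + y ^ 2))) * sinTwoArctan y ^ (2 * (n + 1)) =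
      (π / 4 - Real.arctan y) *
        (sinTwoArctan y ^ (2 * n + 1) * (2 * (1 - y ^ 2) / (1 + y ^ 2) ^ 2)) := by
  rcases eq_or_ne y 0 with rfl | hy
  · simp [sinTwoArctan_zero]
  · rw [show 2 * (n + 1) = 2 * n + 1 + 1 by ring, pow_succ _ (2 * n + 1)]
    nth_rw 2 [sinTwoArctan]
    field_simp

lemma continuous_arctan_kernel_mul_sinTwoArctan_pow (n : ℕ) :
    Continuous fun y : ℝ => (π / 4 - Real.arctan y) * ((1 - y ^ 2) / (y * (1 + y ^ 2)))
        * sinTwoArctan y ^ (2 * (n + 1)) := by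
  simp only [arctan_kernel_mul_sinTwoArctan_pow]
  exact (continuous_const.sub Real.continuous_arctan).mul
    ((continuous_sinTwoArctan.pow _).mul (Continuous.div (by fun_prop) (by fun_prop)
      fun y => by positivity))

lemma continuous_sinTwoArctan_pow_div (n : ℕ) :
    Continuous fun y : ℝ => sinTwoArctan y ^ (2 * n) / (1 + y ^ 2) :=
  Continuous.div (continuous_sinTwoArctan.pow _) (by fun_prop) fun y => by positivity

lemma integral_arctan_sinTwoArctan_pow (n : ℕ) :
    ∫ y in (0 : ℝ)..1, (π / 4 - Real.arctan y) * ((1 - y ^ 2) / (y * (1 + y ^ 2)))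
        * sinTwoArctan y ^ (2 * (n + 1)) =
      π / 8 * (normCentralBinom (n + 1) / ((n : ℝ) + 1)) := by
  have hd : ∀ y ∈ Set.uIcc (0 : ℝ) 1, HasDerivAt
      (fun y => (π / 4 - Real.arctan y) * sinTwoArctan y ^ (2 * (n + 1)))
      (2 * ((n : ℝ) + 1) * ((π / 4 - Real.arctan y) * ((1 - y ^ 2) / (y * (1 + y ^ 2)))
        * sinTwoArctan y ^ (2 * (n + 1))) - sinTwoArctan y ^ (2 * (n + 1)) / (1 + y ^ 2)) y := by
    intro y _
    refine (((Real.hasDerivAt_arctan y).const_sub (π / 4)).mul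
      ((hasDerivAt_sinTwoArctan y).pow (2 * (n + 1)))).congr_deriv ?_
    rw [arctan_kernel_mul_sinTwoArctan_pow, show 2 * (n + 1) - 1 = 2 * n + 1 by omega]
    simp only [Pi.pow_apply]
    push_cast
    ring
  have hc1 := (continuous_arctan_kernel_mul_sinTwoArctan_pow n).const_mul (2 * ((n : ℝ) + 1))
  have hc2 := continuous_sinTwoArctan_pow_div (n + 1)
  have h := intervalIntegral.integral_eq_sub_of_hasDerivAt hd
    ((hc1.sub hc2).intervalIntegrable _ _)
  rw [intervalIntegral.integral_sub (hc1.intervalIntegrable _ _) (hc2.intervalIntegrable _ _),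
    intervalIntegral.integral_const_mul, integral_sinTwoArctan_pow, Real.arctan_one, sub_self,
    zero_mul, sinTwoArctan_zero, zero_pow (by omega), mul_zero, sub_zero, sub_eq_zero] at h
  have hn : (n : ℝ) + 1 ≠ 0 := n.cast_add_one_ne_zero
  apply mul_left_cancel₀ (mul_ne_zero two_ne_zero hn)
  rw [h]
  field_simp
  ring

lemma hasSum_integral_mul_sinTwoArctan_pow {K : ℝ → ℝ}
    (hK : ∀ y ∈ Set.Ioo (0 : ℝ) 1, 0 ≤ K y)
    (hc : ∀ n : ℕ, Continuous fun y => K y * sinTwoArctan y ^ (2 * (n + 1)))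
    (hs : Summable fun n : ℕ => normCentralBinom (n + 1) / ((n : ℝ) + 1) *
      ∫ y in (0 : ℝ)..1, K y * sinTwoArctan y ^ (2 * (n + 1))) :
    HasSum (fun n : ℕ => normCentralBinom (n + 1) / ((n : ℝ) + 1) *
      ∫ y in (0 : ℝ)..1, K y * sinTwoArctan y ^ (2 * (n + 1)))
      (2 * ∫ y in (0 : ℝ)..1, K y * Real.log (1 + y ^ 2)) := by
  simp only [intervalIntegral.integral_of_le zero_le_one,
    MeasureTheory.integral_Ioc_eq_integral_Ioo,
    ← MeasureTheory.integral_const_mul] at hs ⊢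
  have hnorm : ∀ n : ℕ, ∀ y ∈ Set.Ioo (0 : ℝ) 1,
      ‖normCentralBinom (n + 1) / ((n : ℝ) + 1) * (K y * sinTwoArctan y ^ (2 * (n + 1)))‖ =
        normCentralBinom (n + 1) / ((n : ℝ) + 1) * (K y * sinTwoArctan y ^ (2 * (n + 1))) := by
    intro n y hy
    have h1 := hK y hy
    have h2 := sinTwoArctan_nonneg hy.1.le
    have h3 := normCentralBinom_pos (n + 1)
    exact Real.norm_of_nonneg (by positivity)
  have hint : ∀ n : ℕ, MeasureTheory.Integrable
      (fun y => normCentralBinom (n + 1) / ((n : ℝ) + 1) *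
        (K y * sinTwoArctan y ^ (2 * (n + 1))))
      (MeasureTheory.volume.restrict (Set.Ioo (0 : ℝ) 1)) := fun n =>
    (((hc n).const_mul _).integrableOn_Icc (a := 0) (b := 1)).mono_set Set.Ioo_subset_Icc_self
  have h := MeasureTheory.hasSum_integral_of_summable_integral_norm hint
    (hs.congr fun n => MeasureTheory.setIntegral_congr_fun measurableSet_Ioo
      fun y hy => (hnorm n y hy).symm)
  have hval : ∫ y in Set.Ioo (0 : ℝ) 1, ∑' n : ℕ, normCentralBinom (n + 1) / ((n : ℝ) + 1) *
      (K y * sinTwoArctan y ^ (2 * (n + 1))) =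
      ∫ y in Set.Ioo (0 : ℝ) 1, 2 * (K y * Real.log (1 + y ^ 2)) := by
    refine MeasureTheory.setIntegral_congr_fun measurableSet_Ioo fun y hy => ?_
    have hy' :=
      (hasSum_normCentralBinom_mul_sinTwoArctan (Set.Ioo_subset_Ico_self hy)).mul_left (K y)
    rw [mul_left_comm] at hy'
    rw [← hy'.tsum_eq]
    simp only [mul_left_comm (K y)]
  rwa [hval] at h

lemma summable_normCentralBinom_sq_div {k : ℕ} (hk : 1 ≤ k) :
    Summable fun n : ℕ => normCentralBinom (n + 1) ^ 2 / ((n : ℝ) + 1) ^ k := by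
  refine .of_nonneg_of_le (fun n => by positivity) (fun n => ?_)
    (summable_one_div_nat_succ_pow (k := k + 1) (by omega))
  rw [pow_succ' _ k, ← div_div]
  gcongr
  exact normCentralBinom_succ_sq_le n

lemma hasSum_normCentralBinom_sq_div :
    HasSum (fun n : ℕ => normCentralBinom (n + 1) ^ 2 / ((n : ℝ) + 1))
      (4 * Real.log 2 - 8 * catalanG / π) := by
  have hterm : ∀ n : ℕ, normCentralBinom (n + 1) / ((n : ℝ) + 1) *
      ∫ y in (0 : ℝ)..1, (1 / (1 + y ^ 2)) * sinTwoArctan y ^ (2 * (n + 1)) =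
      π / 4 * (normCentralBinom (n + 1) ^ 2 / ((n : ℝ) + 1) ^ 1) := by
    intro n
    simp only [one_div_mul_eq_div, integral_sinTwoArctan_pow]
    ring
  have h := hasSum_integral_mul_sinTwoArctan_pow (K := fun y => 1 / (1 + y ^ 2))
    (fun y _ => by positivity)
    (fun n => by simpa only [one_div_mul_eq_div] using continuous_sinTwoArctan_pow_div (n + 1))
    (by simpa only [hterm] using (summable_normCentralBinom_sq_div le_rfl).mul_left (π / 4))
  simp only [hterm, pow_one] at h
  simp only [one_div_mul_eq_div, integral_log_one_add_sq_div_one_add_sq] at h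
  have h' := h.mul_left (4 / π)
  have hπ := Real.pi_ne_zero
  rw [show 4 * Real.log 2 - 8 * catalanG / π =
    4 / π * (2 * (π / 2 * Real.log 2 - catalanG)) by field_simp; ring]
  exact h'.congr_fun fun n => by field_simp

lemma hasSum_normCentralBinom_sq_div_sq :
    HasSum (fun n : ℕ => normCentralBinom (n + 1) ^ 2 / ((n : ℝ) + 1) ^ 2)
      (3 * π ^ 2 / 2 - 6 * Real.log 2 ^ 2 - 64 * imLi3 / π) := by
  have hterm : ∀ n : ℕ, normCentralBinom (n + 1) / ((n : ℝ) + 1) *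
      ∫ y in (0 : ℝ)..1, (π / 4 - Real.arctan y) * ((1 - y ^ 2) / (y * (1 + y ^ 2)))
        * sinTwoArctan y ^ (2 * (n + 1)) =
      π / 8 * (normCentralBinom (n + 1) ^ 2 / ((n : ℝ) + 1) ^ 2) := by
    intro n
    rw [integral_arctan_sinTwoArctan_pow]
    field_simp
  have h := hasSum_integral_mul_sinTwoArctan_pow
    (K := fun y => (π / 4 - Real.arctan y) * ((1 - y ^ 2) / (y * (1 + y ^ 2))))
    (fun y hy => arctan_kernel_nonneg hy)
    continuous_arctan_kernel_mul_sinTwoArctan_pow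
    (by simpa only [hterm] using (summable_normCentralBinom_sq_div one_le_two).mul_left (π / 8))
  simp only [hterm, integral_arctan_log_kernel] at h
  have h' := h.mul_left (8 / π)
  have hπ := Real.pi_ne_zero
  rw [show 3 * π ^ 2 / 2 - 6 * Real.log 2 ^ 2 - 64 * imLi3 / π =
    8 / π * (2 * (-4 * imLi3 - 3 * π * Real.log 2 ^ 2 / 8 + 3 * π ^ 3 / 32)) by field_simp; ring]
  exact h'.congr_fun fun n => by field_simp

lemma wallis_mul_normCentralBinom_sq (n : ℕ) :
    Real.Wallis.W n * ((2 * n + 1) * normCentralBinom n ^ 2) = 1 := by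
  induction n with
  | zero => simp [Real.Wallis.W, normCentralBinom_zero]
  | succ n ih =>
    refine Eq.trans ?_ ih
    rw [Real.Wallis.W_succ, normCentralBinom_succ, mul_assoc]
    congr 1
    push_cast
    field_simp
    ring

lemma sum_normCentralBinom_sq_div_two_mul_add_one (N : ℕ) :
    ∑ n ∈ Finset.range N, normCentralBinom (n + 1) ^ 2 / (2 * (n : ℝ) + 1) =
      1 - 4 * ((N : ℝ) + 1) ^ 2 / (2 * N + 1) * normCentralBinom (N + 1) ^ 2 := by
  induction N with
  | zero => simp [normCentralBinom_succ, normCentralBinom_zero]; norm_num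
  | succ N ih =>
    rw [Finset.sum_range_succ, ih, normCentralBinom_succ (N + 1)]
    push_cast
    field_simp
    ring

lemma hasSum_normCentralBinom_sq_div_two_mul_add_one :
    HasSum (fun n : ℕ => normCentralBinom (n + 1) ^ 2 / (2 * (n : ℝ) + 1)) (1 - 2 / π) := by
  rw [hasSum_iff_tendsto_nat_of_nonneg fun n => by positivity]
  simp only [sum_normCentralBinom_sq_div_two_mul_add_one]
  refine Filter.Tendsto.const_sub 1 ?_
  have hW := ((Filter.tendsto_add_atTop_iff_nat 1).2 Real.Wallis.tendsto_W_nhds_pi_div_two).inv₀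
    (by positivity)
  have hd : Filter.Tendsto (fun N : ℕ => 2 * (N : ℝ) + 1) Filter.atTop Filter.atTop :=
    Filter.tendsto_atTop_add_const_right _ _
      (tendsto_natCast_atTop_atTop.const_mul_atTop two_pos)
  have hd' : Filter.Tendsto (fun N : ℕ => 2 * (N : ℝ) + 3) Filter.atTop Filter.atTop :=
    Filter.tendsto_atTop_add_const_right _ _
      (tendsto_natCast_atTop_atTop.const_mul_atTop two_pos)
  have h := (((hd.inv_tendsto_atTop).const_add 1).mul ((hd'.inv_tendsto_atTop).const_sub 1)).mul hW
  rw [add_zero, sub_zero, one_mul, one_mul, inv_div] at h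
  refine h.congr fun N => ?_
  rw [inv_eq_of_mul_eq_one_right (wallis_mul_normCentralBinom_sq (N + 1))]
  simp only [Pi.inv_apply]
  push_cast
  field_simp
  ring

theorem central_binom_sq_2n_add_one_series :
    ∑' n : ℕ, ((2*n).choose n : ℝ)^2 * (2 * (n:ℝ) + 1) / (16 ^ n * ((n:ℝ) + 1)^4)
      = 16 - 6 * π^2 - 32 * Real.log 2 + 24 * Real.log 2 ^ 2
        + (64 * catalanG - 32 + 256 * imLi3) / π := by
  have h := (((hasSum_normCentralBinom_sq_div_two_mul_add_one.mul_left 4).sub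
    (hasSum_normCentralBinom_sq_div.mul_left 2)).sub
    hasSum_normCentralBinom_sq_div_sq).mul_left 4
  refine (h.congr_fun fun n => ?_).tsum_eq.trans ?_
  · have hn : (n : ℝ) + 1 ≠ 0 := n.cast_add_one_ne_zero
    have h16 : (16 : ℝ) ^ n = (4 ^ n) ^ 2 := by
      rw [← pow_mul, mul_comm n, pow_mul]
      norm_num
    rw [normCentralBinom_succ, normCentralBinom, Nat.centralBinom_eq_two_mul_choose, h16]
    field_simp
    ring
  · field_simp
    ring
end
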